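/- arXiv:2507.04544 — 5 statements merged into one kernel-verified Lean document; each statement's English description precedes it below -/
import Mathlib

section
/- Let f be holomorphic on the open unit disk 𝔻 with |f(z)| ≤ 1 for all z ∈ 𝔻, and let a_k be its Taylor coefficients at 0. Then for every n ≥ 2, the segment S_{n-2,n}(z) = a_{n-2} z^{n-2} + a_{n-1} z^{n-1} + a_n z^n satisfies sup_{z ∈ 𝔻} |S_{n-2,n}(z)| ≤ ∑_{k=0}^n b_k². -/
open Finset Metric

open scoped PowerSeries

/-- `F` is the sum of the power series `C` near `0`. -/
def IsSumNearZero (C : ℂ⟦X⟧) (F : ℂ → ℂ) : Prop :=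
  ∀ᶠ z : ℂ in nhds 0, HasSum (fun k : ℕ => C.coeff k * z ^ k) (F z)

namespace IsSumNearZero

variable {C D : ℂ⟦X⟧} {F G : ℂ → ℂ}

theorem hasFPowerSeriesAt (h : IsSumNearZero C F) :
    HasFPowerSeriesAt F (FormalMultilinearSeries.ofScalars ℂ fun k => C.coeff k) 0 := by
  rw [hasFPowerSeriesAt_iff]
  filter_upwards [h] with z hz
  simpa [FormalMultilinearSeries.coeff_ofScalars, mul_comm] using hz

theorem unique (h : IsSumNearZero C F) (h' : IsSumNearZero D F) : C = D := by
  ext k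
  have := congrArg (fun p => p.coeff k)
    (h.hasFPowerSeriesAt.eq_formalMultilinearSeries h'.hasFPowerSeriesAt)
  simpa [FormalMultilinearSeries.coeff_ofScalars] using this

theorem mul (h : IsSumNearZero C F) (h' : IsSumNearZero D G) :
    IsSumNearZero (C * D) (fun z => F z * G z) := by
  filter_upwards [h, h'] with z hz hz'
  have hs := (summable_norm_sum_mul_antidiagonal_of_summable_norm
    hz.summable.norm hz'.summable.norm).of_norm.hasSum
  rw [← tsum_mul_tsum_eq_tsum_sum_antidiagonal_of_summable_norm
    hz.summable.norm hz'.summable.norm, hz.tsum_eq, hz'.tsum_eq] at hs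
  refine (congrArg (HasSum · (F z * G z)) (funext fun k => ?_)).mpr hs
  rw [PowerSeries.coeff_mul, Finset.sum_mul]
  refine Finset.sum_congr rfl fun p hp => ?_
  rw [← Finset.HasAntidiagonal.mem_antidiagonal.mp hp, pow_add]
  ring

/-- Cauchy's estimate on the unit circle, in integral form. -/
theorem norm_coeff_le (h : IsSumNearZero C F)
    (hF : DifferentiableOn ℂ F (closedBall 0 1)) (n : ℕ) :
    ‖C.coeff n‖ ≤ (2 * Real.pi)⁻¹ * ∫ θ in 0..2 * Real.pi, ‖F (circleMap 0 1 θ)‖ := by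
  have hC := DifferentiableOn.hasFPowerSeriesOnBall (R := 1) (c := 0) (f := F)
    (by simpa using hF) one_pos
  have he := h.hasFPowerSeriesAt.eq_formalMultilinearSeries hC.hasFPowerSeriesAt
  have hn := norm_cauchyPowerSeries_le F 0 1 n
  rw [NNReal.coe_one] at he
  rw [← he, FormalMultilinearSeries.norm_apply_eq_norm_coef,
    FormalMultilinearSeries.coeff_ofScalars] at hn
  simpa using hn

end IsSumNearZero

theorem Polynomial.isSumNearZero (P : Polynomial ℂ) :
    IsSumNearZero (P : ℂ⟦X⟧) (fun z => P.eval z) := by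
  refine Filter.Eventually.of_forall fun z => ?_
  simp only [Polynomial.coeff_coe]
  rw [Polynomial.eval_eq_sum_range]
  refine hasSum_sum_of_ne_finset_zero fun k hk => ?_
  rw [Polynomial.coeff_eq_zero_of_natDegree_lt (by simpa using hk), zero_mul]

/-- Orthogonality of the characters of the circle. -/
theorem integral_circleMap_pow_mul_conj_pow (i j : ℕ) :
    ∫ θ in 0..2 * Real.pi, circleMap 0 1 θ ^ i * (starRingEnd ℂ) (circleMap 0 1 θ) ^ j =
      if i = j then 2 * (Real.pi : ℂ) else 0 := by
  have hexp (θ : ℝ) : circleMap 0 1 θ ^ i * (starRingEnd ℂ) (circleMap 0 1 θ) ^ j =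
      Complex.exp ((((i : ℂ) - j) * Complex.I) * θ) := by
    simp only [circleMap, zero_add, Complex.ofReal_one, one_mul, ← Complex.exp_conj,
      ← Complex.exp_nat_mul, ← Complex.exp_add, map_mul, Complex.conj_I, Complex.conj_ofReal]
    congr 1
    ring
  simp only [hexp]
  split_ifs with hij
  · simp [hij]
  · have hne : ((i : ℂ) - j) * Complex.I ≠ 0 :=
      mul_ne_zero (sub_ne_zero.mpr (by exact_mod_cast hij)) Complex.I_ne_zero
    rw [integral_exp_mul_complex hne]
    have h1 : Complex.exp ((((i : ℂ) - j) * Complex.I) * ((2 * Real.pi : ℝ) : ℂ)) = 1 := by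
      rw [Complex.exp_eq_one_iff]
      refine ⟨(i : ℤ) - j, ?_⟩
      push_cast
      ring
    rw [h1]
    simp

/-- Parseval's identity for polynomials with real coefficients on the unit circle. -/
theorem integral_norm_sq_sum_circleMap (b : ℕ → ℝ) (s : Finset ℕ) :
    ∫ θ in 0..2 * Real.pi, ‖∑ k ∈ s, (b k : ℂ) * circleMap 0 1 θ ^ k‖ ^ 2 =
      2 * Real.pi * ∑ k ∈ s, b k ^ 2 := by
  have hc : Continuous fun θ : ℝ => circleMap 0 1 θ := continuous_circleMap 0 1
  apply Complex.ofReal_injective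
  rw [← intervalIntegral.integral_ofReal]
  have hpt (θ : ℝ) : ((‖∑ k ∈ s, (b k : ℂ) * circleMap 0 1 θ ^ k‖ ^ 2 : ℝ) : ℂ) =
      ∑ i ∈ s, ∑ j ∈ s, ((b i : ℂ) * b j) *
        (circleMap 0 1 θ ^ i * (starRingEnd ℂ) (circleMap 0 1 θ) ^ j) := by
    push_cast
    rw [← Complex.mul_conj', map_sum, Finset.sum_mul_sum]
    refine Finset.sum_congr rfl fun i _ => Finset.sum_congr rfl fun j _ => ?_
    simp only [map_mul, map_pow, Complex.conj_ofReal]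
    ring
  have hcont (i j : ℕ) : Continuous fun θ : ℝ => ((b i : ℂ) * b j) *
      (circleMap 0 1 θ ^ i * (starRingEnd ℂ) (circleMap 0 1 θ) ^ j) :=
    continuous_const.mul ((hc.pow i).mul ((Complex.continuous_conj.comp hc).pow j))
  simp only [hpt]
  rw [intervalIntegral.integral_finsetSum fun i _ =>
    (continuous_finsetSum s fun j _ => hcont i j).intervalIntegrable _ _]
  push_cast
  rw [Finset.mul_sum]
  refine Finset.sum_congr rfl fun i hi => ?_
  rw [intervalIntegral.integral_finsetSum fun j _ => (hcont i j).intervalIntegrable _ _]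
  simp only [intervalIntegral.integral_const_mul, integral_circleMap_pow_mul_conj_pow,
    mul_ite, mul_zero]
  rw [Finset.sum_ite_eq, if_pos hi]
  ring

/-- Landau's method: multiplying a function bounded by `1` by the square of a polynomial. -/
theorem norm_coeff_mul_trunc_sq_le {C : ℂ⟦X⟧} {g : ℂ → ℂ} (h : IsSumNearZero C g)
    (hg : DifferentiableOn ℂ g (closedBall 0 1)) (hg1 : ∀ z ∈ closedBall (0 : ℂ) 1, ‖g z‖ ≤ 1)
    (b : ℕ → ℝ) (m n : ℕ) :
    ‖(C * (PowerSeries.trunc m (PowerSeries.mk fun k => (b k : ℂ)) : ℂ⟦X⟧) ^ 2).coeff n‖ ≤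
      ∑ k ∈ range m, b k ^ 2 := by
  set P := PowerSeries.trunc m (PowerSeries.mk fun k => (b k : ℂ)) with hP
  have heval (z : ℂ) : P.eval z = ∑ k ∈ range m, (b k : ℂ) * z ^ k := by
    simpa [hP] using PowerSeries.eval₂_trunc_eq_sum_range z (RingHom.id ℂ) m
      (PowerSeries.mk fun k => (b k : ℂ))
  have hsum : IsSumNearZero (C * (P : ℂ⟦X⟧) ^ 2) (fun z => g z * P.eval z ^ 2) := by
    simp only [← Polynomial.coe_pow, ← Polynomial.eval_pow]
    exact h.mul (P ^ 2).isSumNearZero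
  have hd : DifferentiableOn ℂ (fun z => g z * P.eval z ^ 2) (closedBall 0 1) :=
    hg.mul (P.differentiable.pow 2).differentiableOn
  have hmem (θ : ℝ) : circleMap 0 1 θ ∈ closedBall (0 : ℂ) 1 :=
    circleMap_mem_closedBall 0 zero_le_one θ
  have hc : Continuous fun θ : ℝ => circleMap 0 1 θ := continuous_circleMap 0 1
  refine (hsum.norm_coeff_le hd n).trans ?_
  rw [inv_mul_le_iff₀ Real.two_pi_pos, ← integral_norm_sq_sum_circleMap]
  refine intervalIntegral.integral_mono_on Real.two_pi_pos.le
    ((hd.continuousOn.comp_continuous hc hmem).norm.intervalIntegrable _ _)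
    (Continuous.intervalIntegrable (by fun_prop) _ _) fun θ _ => ?_
  rw [norm_mul, norm_pow, heval]
  exact mul_le_of_le_one_left (by positivity) (hg1 _ (hmem θ))

theorem PowerSeries.coeff_mul_trunc_sq {R : Type*} [CommSemiring R] (C B : R⟦X⟧) (n : ℕ) :
    (C * (PowerSeries.trunc (n + 1) B : R⟦X⟧) ^ 2).coeff n = (C * B ^ 2).coeff n := by
  rw [PowerSeries.coeff_mul, PowerSeries.coeff_mul]
  refine Finset.sum_congr rfl fun p hp => ?_
  have hlt : p.2 < n + 1 := by
    have := Finset.HasAntidiagonal.mem_antidiagonal.mp hp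
    omega
  have := congrArg (fun Q => Polynomial.coeff Q p.2) (PowerSeries.trunc_trunc_pow B (n + 1) 2)
  simp only [PowerSeries.coeff_trunc, if_pos hlt] at this
  rw [this]

theorem mk_sq_eq_one_add_X_add_X_sq (b : ℕ → ℝ)
    (hb : ∀ᶠ z : ℂ in nhds 0,
      HasSum (fun k : ℕ => (b k : ℂ) * z ^ k) ((1 + z + z ^ 2) ^ ((1 : ℂ) / 2))) :
    (PowerSeries.mk fun k => (b k : ℂ)) ^ 2 = 1 + PowerSeries.X + PowerSeries.X ^ 2 := by
  have hB : IsSumNearZero (PowerSeries.mk fun k => (b k : ℂ))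
      (fun z => (1 + z + z ^ 2) ^ ((1 : ℂ) / 2)) := by
    simpa [IsSumNearZero] using hb
  have hsq (w : ℂ) : w ^ ((1 : ℂ) / 2) * w ^ ((1 : ℂ) / 2) = w := by
    rw [← sq, one_div]
    exact_mod_cast Complex.cpow_nat_inv_pow w two_ne_zero
  have hBB := hB.mul hB
  simp only [hsq] at hBB
  rw [sq]
  have hP := (1 + Polynomial.X + Polynomial.X ^ 2 : Polynomial ℂ).isSumNearZero
  simp only [Polynomial.coe_add, Polynomial.coe_one, Polynomial.coe_X, Polynomial.coe_pow,
    Polynomial.eval_add, Polynomial.eval_one, Polynomial.eval_X, Polynomial.eval_pow] at hP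
  exact hBB.unique hP

/-- If `f` is holomorphic on the open unit disk with `|f| ≤ 1`,
`a` are its Taylor coefficients at `0`, and `b` are the Taylor coefficients at `0`
of the principal branch of `√(1+z+z²)`, then for every `n ≥ 2` the three-term
segment `S_{n-2,n}(z) = a_{n-2} z^{n-2} + a_{n-1} z^{n-1} + a_n z^n` satisfies
`|S_{n-2,n}(z)| ≤ ∑_{k=0}^n b_k²` for every `z` in the disk. -/
theorem three_term_segment_bound
    (b : ℕ → ℝ)
    (hb : ∀ᶠ z : ℂ in nhds 0,
      HasSum (fun k : ℕ => (b k : ℂ) * z ^ k) ((1 + z + z ^ 2) ^ ((1 : ℂ) / 2)))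
    (f : ℂ → ℂ) (a : ℕ → ℂ)
    (hf : DifferentiableOn ℂ f (ball (0 : ℂ) 1))
    (hf1 : ∀ z ∈ ball (0 : ℂ) 1, ‖f z‖ ≤ 1)
    (ha : ∀ᶠ z : ℂ in nhds 0, HasSum (fun k : ℕ => a k * z ^ k) (f z))
    (n : ℕ) (hn : 2 ≤ n) :
    ∀ z ∈ ball (0 : ℂ) 1,
      ‖∑ k ∈ Finset.Icc (n - 2) n, a k * z ^ k‖ ≤ ∑ k ∈ Finset.range (n + 1), (b k) ^ 2 := by
  intro z hz
  have hmaps : Set.MapsTo (fun w : ℂ => z * w) (closedBall 0 1) (ball 0 1) := fun w hw => by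
    rw [mem_ball_zero_iff] at hz ⊢
    rw [mem_closedBall_zero_iff] at hw
    rw [norm_mul]
    exact (mul_le_of_le_one_right (norm_nonneg z) hw).trans_lt hz
  have hsum : IsSumNearZero (PowerSeries.mk fun k => a k * z ^ k) (fun w => f (z * w)) := by
    have ht : Filter.Tendsto (fun w : ℂ => z * w) (nhds 0) (nhds 0) := by
      simpa using (continuous_const_mul z).tendsto 0
    filter_upwards [ht.eventually ha] with w hw
    simpa [mul_pow, mul_assoc] using hw
  have hbound := norm_coeff_mul_trunc_sq_le hsum
    (hf.comp (by fun_prop) hmaps) (fun w hw => hf1 _ (hmaps hw)) b (n + 1) n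
  rw [PowerSeries.coeff_mul_trunc_sq, mk_sq_eq_one_add_X_add_X_sq b hb] at hbound
  obtain ⟨m, rfl⟩ := Nat.exists_eq_add_of_le' hn
  convert hbound using 2
  rw [Nat.add_sub_cancel, Finset.sum_Icc_succ_top (by omega), Finset.sum_Icc_succ_top (by omega),
    Finset.Icc_self, Finset.sum_singleton, mul_add, mul_add, mul_one, map_add, map_add,
    PowerSeries.coeff_mul_X_pow, PowerSeries.coeff_succ_mul_X]
  simp only [PowerSeries.coeff_mk]
  ring
end

section
/- For every n ≥ 2, the partial sum of squared Taylor coefficients satisfies ∑_{k=0}^n b_k² < 1/3 + 2√3/π. -/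
open Finset

/-- `1 + z + z²` avoids `(-∞, 0]` on the unit disc. -/
theorem one_add_add_sq_mem_slitPlane {z : ℂ} (hz : ‖z‖ < 1) :
    1 + z + z ^ 2 ∈ Complex.slitPlane := by
  have hsq : z.re ^ 2 + z.im ^ 2 < 1 := by
    have h := Complex.sq_norm z
    rw [Complex.normSq_apply] at h
    nlinarith [norm_nonneg z]
  rw [Complex.mem_slitPlane_iff]
  have hre : (1 + z + z ^ 2).re = 1 + z.re + (z.re ^ 2 - z.im ^ 2) := by
    simp [pow_two]
  have him : (1 + z + z ^ 2).im = z.im * (1 + 2 * z.re) := by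
    simp [pow_two]; ring
  rw [hre, him]
  by_cases h : z.im * (1 + 2 * z.re) = 0
  · left
    rcases mul_eq_zero.mp h with h | h
    · rw [h]; nlinarith [sq_nonneg (z.re + 1 / 2)]
    · have : z.re = -1 / 2 := by linarith
      rw [this] at hsq ⊢
      nlinarith
  · exact Or.inr h

theorem cpow_one_half_sq (w : ℂ) : (w ^ ((1 : ℂ) / 2)) ^ 2 = w := by
  simp

theorem norm_cpow_one_half_sq (w : ℂ) : ‖w ^ ((1 : ℂ) / 2)‖ ^ 2 = ‖w‖ := by
  rw [← norm_pow, cpow_one_half_sq]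

/-- A power series that represents, near `0`, a function differentiable on a disc represents it on
the whole disc. -/
theorem hasSum_of_eventually_hasSum_of_differentiableOn {a : ℕ → ℂ} {f : ℂ → ℂ} {R : ℝ}
    (hf : DifferentiableOn ℂ f (Metric.ball 0 R))
    (ha : ∀ᶠ z in nhds 0, HasSum (fun k => a k * z ^ k) (f z)) {z : ℂ}
    (hz : z ∈ Metric.ball 0 R) : HasSum (fun k => a k * z ^ k) (f z) := by
  have hR : 0 < R := Metric.pos_of_mem_ball hz
  have taylor : ∀ w ∈ Metric.ball (0 : ℂ) R,
      HasSum (fun k => ((k.factorial : ℂ)⁻¹ * iteratedDeriv k f 0) * w ^ k) (f w) := by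
    intro w hw
    have := Complex.hasSum_taylorSeries_on_ball hf hw
    simpa [mul_assoc, mul_comm, mul_left_comm] using this
  let p : FormalMultilinearSeries ℂ ℂ ℂ := .ofScalars ℂ a
  let q : FormalMultilinearSeries ℂ ℂ ℂ :=
    .ofScalars ℂ fun k => (k.factorial : ℂ)⁻¹ * iteratedDeriv k f 0
  have hp : HasFPowerSeriesAt f p 0 := by
    rw [hasFPowerSeriesAt_iff]
    filter_upwards [ha] with w hw
    simpa [p, FormalMultilinearSeries.coeff_ofScalars, mul_comm] using hw
  have hq : HasFPowerSeriesAt f q 0 := by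
    rw [hasFPowerSeriesAt_iff]
    filter_upwards [Metric.ball_mem_nhds 0 hR] with w hw
    simpa [q, FormalMultilinearSeries.coeff_ofScalars, mul_comm] using taylor w hw
  have hpq : p = q := hp.eq_formalMultilinearSeries hq
  have hcoeff : a = fun k => (k.factorial : ℂ)⁻¹ * iteratedDeriv k f 0 := by
    funext k
    have := congrArg (fun s => s.coeff k) hpq
    simpa [p, q, FormalMultilinearSeries.coeff_ofScalars] using this
  rw [hcoeff]
  exact taylor z hz

/-- Bessel's inequality for a power series on a circle inside its disc of convergence. -/
theorem sum_sq_norm_coeff_mul_le_circleAverage {a : ℕ → ℂ} {f : ℂ → ℂ} {r : ℝ} (hr : 0 ≤ r)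
    (hsum : ∀ z : ℂ, ‖z‖ = r → HasSum (fun k => a k * z ^ k) (f z)) (n : ℕ) :
    ∑ k ∈ range n, (‖a k‖ * r ^ k) ^ 2 ≤
      (2 * Real.pi)⁻¹ * ∫ θ in (0 : ℝ)..2 * Real.pi, ‖f (circleMap 0 r θ)‖ ^ 2 := by
  let P : ℕ → Polynomial ℂ := fun m => ∑ k ∈ range m, Polynomial.monomial k (a k * r ^ k)
  have hcoeff (m k : ℕ) : (P m).coeff k = if k < m then a k * r ^ k else 0 := by
    simp [P, Polynomial.coeff_monomial]
  have heval (m : ℕ) (θ : ℝ) :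
      (P m).eval (circleMap 0 1 θ) = ∑ k ∈ range m, a k * circleMap 0 r θ ^ k := by
    simp [P, Polynomial.eval_finsetSum, circleMap, mul_pow, mul_assoc]
  have parseval (m : ℕ) : ∑ k ∈ range m, (‖a k‖ * r ^ k) ^ 2 =
      (2 * Real.pi)⁻¹ * ∫ θ in (0 : ℝ)..2 * Real.pi,
        ‖∑ k ∈ range m, a k * circleMap 0 r θ ^ k‖ ^ 2 := by
    have h := (P m).sum_sq_norm_coeff_eq_circleAverage
    simp only [Real.circleAverage, heval, smul_eq_mul] at h
    rw [← h, Finset.sum_subset (s₁ := (P m).support) (s₂ := range m)]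
    · refine Finset.sum_congr rfl fun k hk => ?_
      simp [hcoeff, Finset.mem_range.mp hk, abs_of_nonneg hr]
    · intro k hk
      by_contra hkm
      simp [hcoeff] at hk hkm
      omega
    · intro k _ hk
      simp [Polynomial.notMem_support_iff.mp hk]
  have hnorm : Summable fun k => ‖a k‖ * r ^ k := by
    have := (hsum r (by simp [abs_of_nonneg hr])).summable.norm
    simpa [abs_of_nonneg hr] using this
  have hlim : Filter.Tendsto
      (fun m => ∫ θ in (0 : ℝ)..2 * Real.pi, ‖∑ k ∈ range m, a k * circleMap 0 r θ ^ k‖ ^ 2)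
      Filter.atTop (nhds (∫ θ in (0 : ℝ)..2 * Real.pi, ‖f (circleMap 0 r θ)‖ ^ 2)) := by
    refine intervalIntegral.tendsto_integral_filter_of_dominated_convergence
      (fun _ => (∑' k, ‖a k‖ * r ^ k) ^ 2) ?_ ?_ intervalIntegrable_const ?_
    · exact .of_forall fun m => Continuous.aestronglyMeasurable (by fun_prop)
    · refine .of_forall fun m => .of_forall fun θ _ => ?_
      rw [Real.norm_of_nonneg (by positivity)]
      gcongr
      calc ‖∑ k ∈ range m, a k * circleMap 0 r θ ^ k‖
          ≤ ∑ k ∈ range m, ‖a k * circleMap 0 r θ ^ k‖ := norm_sum_le _ _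
        _ = ∑ k ∈ range m, ‖a k‖ * r ^ k := by simp [abs_of_nonneg hr]
        _ ≤ ∑' k, ‖a k‖ * r ^ k := hnorm.sum_le_tsum _ fun k _ => by positivity
    · refine .of_forall fun θ _ => ?_
      exact ((hsum _ (by simp [abs_of_nonneg hr])).tendsto_sum_nat.norm).pow 2
  refine ge_of_tendsto (hlim.const_mul _) ?_
  filter_upwards [Filter.eventually_ge_atTop n] with m hm
  rw [← parseval]
  exact Finset.sum_le_sum_of_subset_of_nonneg (Finset.range_subset_range.mpr hm)
    fun k _ _ => by positivity

theorem norm_one_add_circleMap_add_sq (θ : ℝ) :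
    ‖1 + circleMap 0 1 θ + circleMap 0 1 θ ^ 2‖ = |1 + 2 * Real.cos θ| := by
  have h : 1 + circleMap 0 1 θ + circleMap 0 1 θ ^ 2 =
      circleMap 0 1 θ * ((1 + 2 * Real.cos θ : ℝ) : ℂ) := by
    have h1 : Complex.exp (θ * Complex.I) * Complex.exp (-θ * Complex.I) = 1 := by
      rw [← Complex.exp_add]; simp
    simp only [circleMap, Complex.ofReal_one, one_mul, zero_add]
    push_cast
    rw [Complex.two_cos]
    linear_combination -h1
  rw [h, norm_mul, norm_circleMap_zero, Complex.norm_real, Real.norm_eq_abs]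
  simp

theorem integral_abs_one_add_two_mul_cos :
    ∫ θ in (0 : ℝ)..2 * Real.pi, |1 + 2 * Real.cos θ| =
      2 * Real.pi / 3 + 4 * Real.sqrt 3 := by
  have hpi := Real.pi_pos
  have habs (a b : ℝ) : IntervalIntegrable (fun θ => |1 + 2 * Real.cos θ|)
      MeasureTheory.volume a b := Continuous.intervalIntegrable (by fun_prop) a b
  have hanti (a b : ℝ) : ∫ θ in a..b, (1 + 2 * Real.cos θ) =
      (b - a) + 2 * (Real.sin b - Real.sin a) := by
    rw [intervalIntegral.integral_add (by simp) (Continuous.intervalIntegrable (by fun_prop) _ _)]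
    simp
  have hcos : Real.cos (2 * Real.pi / 3) = -1 / 2 := by
    rw [show 2 * Real.pi / 3 = Real.pi - Real.pi / 3 by ring,
      Real.cos_pi_sub, Real.cos_pi_div_three]
    norm_num
  have hsin : Real.sin (2 * Real.pi / 3) = Real.sqrt 3 / 2 := by
    rw [show 2 * Real.pi / 3 = Real.pi - Real.pi / 3 by ring,
      Real.sin_pi_sub, Real.sin_pi_div_three]
  have h₁ : ∫ θ in (0 : ℝ)..2 * Real.pi / 3, |1 + 2 * Real.cos θ| =
      2 * Real.pi / 3 + Real.sqrt 3 := by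
    rw [intervalIntegral.integral_congr (g := fun θ => 1 + 2 * Real.cos θ), hanti, hsin]
    · simp; ring
    · intro θ hθ
      rw [Set.uIcc_of_le (by positivity)] at hθ
      have := Real.cos_le_cos_of_nonneg_of_le_pi hθ.1 (by linarith) hθ.2
      exact abs_of_nonneg (by linarith)
  have h₂ : ∫ θ in 2 * Real.pi / 3..Real.pi, |1 + 2 * Real.cos θ| =
      -(Real.pi / 3) + Real.sqrt 3 := by
    rw [intervalIntegral.integral_congr (g := fun θ => -(1 + 2 * Real.cos θ)),
      intervalIntegral.integral_neg, hanti, hsin]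
    · simp; ring
    · intro θ hθ
      rw [Set.uIcc_of_le (by linarith)] at hθ
      have := Real.cos_le_cos_of_nonneg_of_le_pi (by positivity) hθ.2 hθ.1
      exact abs_of_nonpos (by linarith)
  have half : ∫ θ in (0 : ℝ)..Real.pi, |1 + 2 * Real.cos θ| =
      Real.pi / 3 + 2 * Real.sqrt 3 := by
    rw [← intervalIntegral.integral_add_adjacent_intervals (habs _ _) (habs _ _), h₁, h₂]
    ring
  have reflect : ∫ θ in Real.pi..2 * Real.pi, |1 + 2 * Real.cos θ| =
      ∫ θ in (0 : ℝ)..Real.pi, |1 + 2 * Real.cos θ| := by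
    have := intervalIntegral.integral_comp_sub_left (a := 0) (b := Real.pi)
      (fun θ => |1 + 2 * Real.cos θ|) (2 * Real.pi)
    simp only [Real.cos_two_pi_sub, sub_zero] at this
    rw [this]
    congr 1
    ring
  rw [← intervalIntegral.integral_add_adjacent_intervals (habs _ _) (habs _ _), reflect, half]
  ring

/-- `1 + X + X²` is separable, hence not a square. -/
theorem one_add_X_add_X_sq_ne_sq (P : Polynomial ℂ) :
    P ^ 2 ≠ 1 + Polynomial.X + Polynomial.X ^ 2 := by
  intro h
  have hdeg : 0 < P.degree := by
    by_contra hdeg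
    obtain ⟨c, rfl⟩ : ∃ c, P = Polynomial.C c :=
      ⟨_, Polynomial.eq_C_of_degree_le_zero (not_lt.mp hdeg)⟩
    have h₁ := congrArg (fun p => (Polynomial.derivative p).eval 0) h
    simp [Polynomial.derivative_pow] at h₁
  obtain ⟨w, hw⟩ := Complex.exists_root hdeg
  have hw' : P.eval w = 0 := hw
  have h₀ := congrArg (Polynomial.eval w) h
  have h₁ := congrArg (fun p => (Polynomial.derivative p).eval w) h
  simp [Polynomial.derivative_pow, hw'] at h₀ h₁
  have : (3 : ℂ) = 0 := by linear_combination -4 * h₀ + (1 + 2 * w) * h₁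
  norm_num at this

theorem exists_lt_coeff_ne_zero {b : ℕ → ℂ}
    (hb : ∀ᶠ z : ℂ in nhds 0, HasSum (fun k => b k * z ^ k) ((1 + z + z ^ 2) ^ ((1 : ℂ) / 2)))
    (n : ℕ) : ∃ m, n < m ∧ b m ≠ 0 := by
  by_contra! hzero
  let P : Polynomial ℂ := ∑ k ∈ range (n + 1), Polynomial.monomial k (b k)
  refine one_add_X_add_X_sq_ne_sq P (Polynomial.eq_of_infinite_eval_eq _ _ ?_)
  refine infinite_of_mem_nhds (0 : ℂ) ?_
  filter_upwards [hb] with z hz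
  have hP : P.eval z = (1 + z + z ^ 2) ^ ((1 : ℂ) / 2) := by
    refine HasSum.unique ?_ hz
    simp only [P, Polynomial.eval_finsetSum, Polynomial.eval_monomial]
    refine hasSum_sum_of_ne_finset_zero fun k hk => ?_
    rw [hzero k (by simpa using hk), zero_mul]
  simp [hP]

theorem sum_sq_norm_coeff_le {b : ℕ → ℂ}
    (hb : ∀ᶠ z : ℂ in nhds 0, HasSum (fun k => b k * z ^ k) ((1 + z + z ^ 2) ^ ((1 : ℂ) / 2)))
    (n : ℕ) : ∑ k ∈ range n, ‖b k‖ ^ 2 ≤ 1 / 3 + 2 * Real.sqrt 3 / Real.pi := by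
  have hdiff : DifferentiableOn ℂ (fun z : ℂ => (1 + z + z ^ 2) ^ ((1 : ℂ) / 2))
      (Metric.ball 0 1) := by
    refine DifferentiableOn.cpow_const (by fun_prop) fun z hz => ?_
    exact one_add_add_sq_mem_slitPlane (by simpa using hz)
  let I : ℝ → ℝ := fun r => (2 * Real.pi)⁻¹ *
    ∫ θ in (0 : ℝ)..2 * Real.pi, ‖1 + circleMap 0 r θ + circleMap 0 r θ ^ 2‖
  have hle : ∀ r ∈ Set.Ico (0 : ℝ) 1, ∑ k ∈ range n, (‖b k‖ * r ^ k) ^ 2 ≤ I r := by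
    intro r hr
    have := sum_sq_norm_coeff_mul_le_circleAverage hr.1 (fun z hz =>
      hasSum_of_eventually_hasSum_of_differentiableOn hdiff hb (z := z) (by simp [hz, hr.2])) n
    simpa only [norm_cpow_one_half_sq] using this
  have hI : Continuous I := by
    refine continuous_const.mul
      (intervalIntegral.continuous_parametric_intervalIntegral_of_continuous' ?_ _ _)
    simp only [Function.uncurry_def, circleMap]
    fun_prop
  have hS : Continuous fun r : ℝ => ∑ k ∈ range n, (‖b k‖ * r ^ k) ^ 2 := by fun_prop
  have hmem : (1 : ℝ) ∈ closure (Set.Ico (0 : ℝ) 1) := by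
    rw [closure_Ico zero_ne_one]; simp
  have hone := le_on_closure hle hS.continuousOn hI.continuousOn hmem
  simp only [I, norm_one_add_circleMap_add_sq, integral_abs_one_add_two_mul_cos, one_pow,
    mul_one] at hone
  refine hone.trans_eq ?_
  have := Real.pi_pos
  field_simp
  ring

/-- Let `b` be the Taylor coefficients at `0` of the principal branch
of `√(1+z+z²)`. Then for every `n ≥ 2`, `∑_{k=0}^n b_k² < 1/3 + 2√3/π`. -/
theorem sum_sq_coeff_lt
    (b : ℕ → ℝ)
    (hb : ∀ᶠ z : ℂ in nhds 0,
      HasSum (fun k : ℕ => (b k : ℂ) * z ^ k) ((1 + z + z ^ 2) ^ ((1 : ℂ) / 2)))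
    (n : ℕ) (hn : 2 ≤ n) :
    ∑ k ∈ Finset.range (n + 1), (b k) ^ 2 < 1 / 3 + 2 * Real.sqrt 3 / Real.pi := by
  obtain ⟨m, hnm, hm⟩ := exists_lt_coeff_ne_zero hb n
  have hm' : b m ≠ 0 := by exact_mod_cast hm
  calc ∑ k ∈ range (n + 1), b k ^ 2
      < ∑ k ∈ range (m + 1), b k ^ 2 :=
        Finset.sum_lt_sum_of_subset (i := m) (by simp; omega) (by simp) (by simp; omega)
          (by positivity) fun k _ _ => sq_nonneg _
    _ ≤ 1 / 3 + 2 * Real.sqrt 3 / Real.pi := by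
        simpa using sum_sq_norm_coeff_le hb (m + 1)
end

section
/- For every n ≥ 0, the Taylor polynomial T_n(z) = ∑_{k=0}^n b_k z^k has no zeros in the closed unit disk {z ∈ ℂ : |z| ≤ 1}. -/
open Finset

/-- The Taylor coefficients of `√(1 - z)` at `0`. -/
noncomputable def sqrtOneSubCoeff : ℕ → ℝ
  | 0 => 1
  | k + 1 => (2 * k - 1) / (2 * (k + 1)) * sqrtOneSubCoeff k

namespace sqrtOneSubCoeff

theorem zero : sqrtOneSubCoeff 0 = 1 := rfl

theorem succ (k : ℕ) :
    2 * ((k : ℝ) + 1) * sqrtOneSubCoeff (k + 1) = (2 * k - 1) * sqrtOneSubCoeff k := by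
  rw [sqrtOneSubCoeff]
  field_simp

theorem succ_neg (k : ℕ) : sqrtOneSubCoeff (k + 1) < 0 := by
  induction k with
  | zero => norm_num [sqrtOneSubCoeff]
  | succ k ih =>
    have h := succ (k + 1)
    push_cast at h
    have hk : (0 : ℝ) ≤ k := k.cast_nonneg
    nlinarith

theorem neg_of_pos {k : ℕ} (hk : 1 ≤ k) : sqrtOneSubCoeff k < 0 := by
  obtain ⟨j, rfl⟩ := Nat.exists_eq_add_of_le' hk
  exact succ_neg j

theorem sum_range_succ (m : ℕ) :
    ∑ j ∈ range (m + 1), sqrtOneSubCoeff j = -(2 * m + 2) * sqrtOneSubCoeff (m + 1) := by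
  induction m with
  | zero => norm_num [sqrtOneSubCoeff]
  | succ m ih =>
    rw [Finset.sum_range_succ, ih]
    have h := succ (m + 1)
    push_cast at h ⊢
    linear_combination h

theorem sum_range_pos (m : ℕ) : 0 < ∑ j ∈ range (m + 1), sqrtOneSubCoeff j := by
  rw [sum_range_succ]
  have := succ_neg m
  have hm : (0 : ℝ) ≤ m := m.cast_nonneg
  nlinarith

theorem summable : Summable sqrtOneSubCoeff := by
  refine (summable_nat_add_iff 1).1 (Summable.of_neg ?_)
  refine summable_of_sum_range_le (c := 1) (fun k => (neg_pos.2 (succ_neg k)).le) fun m => ?_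
  have h := sum_range_pos m
  rw [Finset.sum_range_succ'] at h
  simp only [zero] at h
  rw [sum_neg_distrib]
  linarith

theorem tsum_nonneg : 0 ≤ ∑' k, sqrtOneSubCoeff k :=
  ge_of_tendsto summable.hasSum.tendsto_sum_nat <|
    (Filter.eventually_ge_atTop 1).mono fun m hm => by
      obtain ⟨j, rfl⟩ := Nat.exists_eq_add_of_le' hm
      exact (sum_range_pos j).le

theorem sub_eq (k : ℕ) :
    2 * ((k : ℝ) + 1) * (sqrtOneSubCoeff (k + 1) - sqrtOneSubCoeff k) =
      -3 * sqrtOneSubCoeff k := by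
  linear_combination succ k

theorem sub_nonneg (k : ℕ) : 0 ≤ sqrtOneSubCoeff (k + 2) - sqrtOneSubCoeff (k + 1) := by
  have h := sub_eq (k + 1)
  have := succ_neg k
  push_cast at h
  have hk : (0 : ℝ) ≤ k := k.cast_nonneg
  nlinarith

theorem sub_le (k : ℕ) : sqrtOneSubCoeff (k + 4) - sqrtOneSubCoeff (k + 3) ≤
    2 * (sqrtOneSubCoeff (k + 5) - sqrtOneSubCoeff (k + 4)) := by
  have h1 := succ (k + 4)
  have h2 := succ (k + 3)
  have := succ_neg (k + 2)
  push_cast at h1 h2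
  have hk : (0 : ℝ) ≤ k := k.cast_nonneg
  have e2 : sqrtOneSubCoeff (k + 4) = (2 * k + 5) / (2 * (k + 4)) * sqrtOneSubCoeff (k + 3) := by
    field_simp; linear_combination h2
  have e1 : sqrtOneSubCoeff (k + 5) = (2 * k + 7) / (2 * (k + 5)) * sqrtOneSubCoeff (k + 4) := by
    field_simp; linear_combination h1
  have : 2 * (sqrtOneSubCoeff (k + 5) - sqrtOneSubCoeff (k + 4)) -
      (sqrtOneSubCoeff (k + 4) - sqrtOneSubCoeff (k + 3))
      = - (3 * k) / (2 * (k + 4) * (k + 5)) * sqrtOneSubCoeff (k + 3) := by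
    rw [e1, e2]; field_simp; ring
  have h3 : 0 ≤ (3 * (k : ℝ)) / (2 * (k + 4) * (k + 5)) := by positivity
  have : - (3 * (k : ℝ)) / (2 * (k + 4) * (k + 5)) = - ((3 * k) / (2 * (k + 4) * (k + 5))) := by
    ring
  nlinarith

theorem tendsto_ratio (j : ℕ) :
    Filter.Tendsto (fun k => sqrtOneSubCoeff (k + 1) / sqrtOneSubCoeff (k + 1 + j))
      Filter.atTop (nhds 1) := by
  induction j with
  | zero =>
    refine tendsto_const_nhds.congr fun k => ?_
    rw [add_zero, div_self (succ_neg k).ne]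
  | succ j ih =>
    have h : Filter.Tendsto (fun k : ℕ => 1 + 3 / (2 * ((k : ℝ) + 1 + j) - 1))
        Filter.atTop (nhds (1 + 0)) := by
      refine tendsto_const_nhds.add (Filter.Tendsto.div_atTop tendsto_const_nhds ?_)
      refine Filter.tendsto_atTop_mono (fun k => ?_) tendsto_natCast_atTop_atTop
      have hk : (0 : ℝ) ≤ k := k.cast_nonneg
      have hj : (0 : ℝ) ≤ j := j.cast_nonneg
      linarith
    have h2 := ih.mul h
    rw [add_zero, mul_one] at h2
    refine h2.congr fun k => ?_
    have h3 := succ (k + 1 + j)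
    have hk : (0 : ℝ) ≤ k := k.cast_nonneg
    have hj : (0 : ℝ) ≤ j := j.cast_nonneg
    have n1 : sqrtOneSubCoeff (k + 1 + j) ≠ 0 := (neg_of_pos (by omega)).ne
    have n2 : sqrtOneSubCoeff (k + 1 + (j + 1)) ≠ 0 := (neg_of_pos (by omega)).ne
    have n3 : (2 * ((k : ℝ) + 1 + j) - 1) ≠ 0 := by nlinarith
    rw [← add_assoc] at n2 ⊢
    push_cast at h3
    field_simp
    linear_combination sqrtOneSubCoeff (k + 1) * h3

end sqrtOneSubCoeff

theorem PowerSeries.mk_mul_self_of_hasSum (b : ℕ → ℝ)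
    (hb : ∀ᶠ z : ℂ in nhds 0,
      HasSum (fun k : ℕ => (b k : ℂ) * z ^ k) ((1 + z + z ^ 2) ^ ((1 : ℂ) / 2))) :
    PowerSeries.mk b * PowerSeries.mk b = 1 + PowerSeries.X + PowerSeries.X ^ 2 := by
  set P : PowerSeries ℝ := 1 + PowerSeries.X + PowerSeries.X ^ 2 with hP
  set f : ℂ → ℂ := fun z => (1 + z + z ^ 2) ^ ((1 : ℂ) / 2)
  set p : FormalMultilinearSeries ℂ ℂ ℂ :=
    FormalMultilinearSeries.ofScalars ℂ fun k => (b k : ℂ)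
  have hp : HasFPowerSeriesAt f p 0 := by
    rw [hasFPowerSeriesAt_iff]
    filter_upwards [hb] with z hz
    simpa [p, f, FormalMultilinearSeries.coeff_ofScalars, mul_comm] using hz
  obtain ⟨r, hr⟩ := hp
  set c : FormalMultilinearSeries ℂ ℂ ℂ :=
    FormalMultilinearSeries.ofScalars ℂ fun k =>
      ((PowerSeries.coeff k (PowerSeries.mk b * PowerSeries.mk b) : ℝ) : ℂ)
  set e : FormalMultilinearSeries ℂ ℂ ℂ :=
    FormalMultilinearSeries.ofScalars ℂ fun k => ((PowerSeries.coeff k P : ℝ) : ℂ)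
  have hc : HasFPowerSeriesAt (fun z : ℂ => 1 + z + z ^ 2) c 0 := by
    rw [hasFPowerSeriesAt_iff]
    have hball : ∀ᶠ z : ℂ in nhds 0, z ∈ Metric.eball (0 : ℂ) r :=
      Metric.eball_mem_nhds _ hr.r_pos
    filter_upwards [hb, hball] with z hz hzr
    have hs : Summable fun k => ‖(b k : ℂ) * z ^ k‖ := by
      have := p.summable_norm_apply (Metric.eball_subset_eball hr.r_le hzr)
      refine this.congr fun k => ?_
      simp [p, mul_comm]
    have h1 := tsum_mul_tsum_eq_tsum_sum_antidiagonal_of_summable_norm hs hs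
    have h2 := (summable_norm_sum_mul_antidiagonal_of_summable_norm hs hs).of_norm.hasSum
    rw [← h1, hz.tsum_eq] at h2
    have h3 : ((1 + z + z ^ 2) ^ ((1 : ℂ) / 2)) * ((1 + z + z ^ 2) ^ ((1 : ℂ) / 2))
        = 1 + z + z ^ 2 := by
      rw [← sq, one_div]
      exact Complex.cpow_nat_inv_pow _ two_ne_zero
    rw [h3] at h2
    convert h2 using 1
    · ext k
      simp only [c, FormalMultilinearSeries.coeff_ofScalars, PowerSeries.coeff_mul,
        PowerSeries.coeff_mk, smul_eq_mul]
      push_cast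
      rw [mul_sum]
      refine sum_congr rfl fun ij hij => ?_
      rw [← mem_antidiagonal.1 hij]
      ring
    · simp only [zero_add]
  have he : HasFPowerSeriesAt (fun z : ℂ => 1 + z + z ^ 2) e 0 := by
    rw [hasFPowerSeriesAt_iff]
    refine Filter.Eventually.of_forall fun z => ?_
    have hsum : 1 + (0 + z) + (0 + z) ^ 2 = ∑ k ∈ range 3, z ^ k • e.coeff k := by
      simp [sum_range_succ, e, FormalMultilinearSeries.coeff_ofScalars, P,
        PowerSeries.coeff_X, PowerSeries.coeff_X_pow, PowerSeries.coeff_one]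
    rw [hsum]
    refine hasSum_sum_of_ne_finset_zero fun k hk => ?_
    have hk : 3 ≤ k := by simpa using hk
    have h0 : k ≠ 0 := by omega
    have h1 : k ≠ 1 := by omega
    have h2 : k ≠ 2 := by omega
    simp [e, FormalMultilinearSeries.coeff_ofScalars, P,
      PowerSeries.coeff_X, PowerSeries.coeff_X_pow, PowerSeries.coeff_one, h0, h1, h2]
  have hce := hc.eq_formalMultilinearSeries he
  ext k
  have := congrArg (fun q => FormalMultilinearSeries.coeff q k) hce
  simpa [c, e, FormalMultilinearSeries.coeff_ofScalars, -map_add] using this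

theorem apply_zero_of_hasSum (b : ℕ → ℝ)
    (hb : ∀ᶠ z : ℂ in nhds 0,
      HasSum (fun k : ℕ => (b k : ℂ) * z ^ k) ((1 + z + z ^ 2) ^ ((1 : ℂ) / 2))) :
    b 0 = 1 := by
  have h := hb.self_of_nhds
  have h2 := hasSum_single (f := fun k : ℕ => (b k : ℂ) * 0 ^ k) 0 (by simp +contextual)
  have := h.unique h2
  simpa using this.symm

open PowerSeries in
theorem two_mul_derivative_of_mul_self {B : PowerSeries ℝ} (h : B * B = 1 + X + X ^ 2) :
    2 * (1 + X + X ^ 2) * d⁄dX ℝ B = (1 + 2 * X) * B := by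
  have h1 := congrArg (d⁄dX ℝ) h
  have h2 : d⁄dX ℝ (1 + X + X ^ 2 : PowerSeries ℝ) = 1 + 2 * X := by
    simp [Derivation.leibniz_pow, PowerSeries.derivative_X]
  rw [h2, Derivation.leibniz, smul_eq_mul] at h1
  rw [← h]
  linear_combination B * h1

open PowerSeries in
/-- Coefficients of the residual of `F` in the differential equation of `√(1 + X + X²)`. -/
theorem coeff_residual (F : PowerSeries ℝ) (k : ℕ) :
    coeff (k + 2) (2 * (1 + X + X ^ 2) * d⁄dX ℝ F - (1 + 2 * X) * F) =
      2 * (k + 3) * coeff (k + 3) F + (2 * k + 3) * coeff (k + 2) F + 2 * k * coeff (k + 1) F := by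
  have h : 2 * (1 + X + X ^ 2) * d⁄dX ℝ F - (1 + 2 * X) * F = (d⁄dX ℝ F + d⁄dX ℝ F) +
      X * (d⁄dX ℝ F + d⁄dX ℝ F) + X ^ 2 * (d⁄dX ℝ F + d⁄dX ℝ F) - F - X * (F + F) := by ring
  rw [h]
  have e : coeff (k + 2) (X ^ 2 * (d⁄dX ℝ F + d⁄dX ℝ F)) = coeff k (d⁄dX ℝ F + d⁄dX ℝ F) :=
    coeff_X_pow_mul _ 2 k
  simp only [map_sub, map_add, e, show k + 2 = (k + 1) + 1 from rfl, coeff_succ_X_mul,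
    coeff_derivative]
  push_cast
  ring

open PowerSeries in
theorem coeff_zero_residual (F : PowerSeries ℝ) :
    coeff 0 (2 * (1 + X + X ^ 2) * d⁄dX ℝ F - (1 + 2 * X) * F) = 2 * coeff 1 F - coeff 0 F := by
  have h : 2 * (1 + X + X ^ 2) * d⁄dX ℝ F - (1 + 2 * X) * F = (d⁄dX ℝ F + d⁄dX ℝ F) - F +
      X * ((1 + X) * (d⁄dX ℝ F + d⁄dX ℝ F) - (F + F)) := by ring
  rw [h]
  simp only [map_sub, map_add, coeff_zero_X_mul, coeff_derivative]
  push_cast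
  ring

open PowerSeries in
theorem coeff_one_residual (F : PowerSeries ℝ) :
    coeff 1 (2 * (1 + X + X ^ 2) * d⁄dX ℝ F - (1 + 2 * X) * F) =
      4 * coeff 2 F + coeff 1 F - 2 * coeff 0 F := by
  have h : 2 * (1 + X + X ^ 2) * d⁄dX ℝ F - (1 + 2 * X) * F = (d⁄dX ℝ F + d⁄dX ℝ F) - F +
      X * (d⁄dX ℝ F + d⁄dX ℝ F - (F + F) + X * (d⁄dX ℝ F + d⁄dX ℝ F)) := by ring
  have h1 (f : PowerSeries ℝ) : coeff 1 (X * f) = coeff 0 f := coeff_succ_X_mul 0 f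
  have h2 : coeff 1 (d⁄dX ℝ F) = coeff 2 F * 2 := by rw [coeff_derivative]; norm_num
  rw [h]
  simp only [map_sub, map_add, coeff_zero_X_mul, h1, h2, coeff_derivative]
  push_cast
  ring

/-- The Taylor coefficients of `√(1 + z + z²)` at `0`, described by their recurrence. -/
structure IsSqrtCoeff (b : ℕ → ℝ) : Prop where
  zero : b 0 = 1
  one : 2 * b 1 = b 0
  two : 4 * b 2 + b 1 = 2 * b 0
  step (k : ℕ) : 2 * ((k : ℝ) + 3) * b (k + 3) + (2 * k + 3) * b (k + 2) + 2 * k * b (k + 1) = 0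

theorem isSqrtCoeff_of_hasSum {b : ℕ → ℝ}
    (hb : ∀ᶠ z : ℂ in nhds 0,
      HasSum (fun k : ℕ => (b k : ℂ) * z ^ k) ((1 + z + z ^ 2) ^ ((1 : ℂ) / 2))) :
    IsSqrtCoeff b := by
  have h := sub_eq_zero.2
    (two_mul_derivative_of_mul_self (PowerSeries.mk_mul_self_of_hasSum b hb))
  refine ⟨apply_zero_of_hasSum b hb, ?_, ?_, fun k => ?_⟩
  · have := coeff_zero_residual (PowerSeries.mk b)
    rw [h] at this
    simp only [map_zero, PowerSeries.coeff_mk] at this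
    linarith
  · have := coeff_one_residual (PowerSeries.mk b)
    rw [h] at this
    simp only [map_zero, PowerSeries.coeff_mk] at this
    linarith
  · have := coeff_residual (PowerSeries.mk b) k
    rw [h] at this
    simp only [map_zero, PowerSeries.coeff_mk] at this
    linarith

/-- The coefficients of the Taylor polynomial of degree `n`. -/
def truncCoeff (b : ℕ → ℝ) (n k : ℕ) : ℝ := if k ≤ n then b k else 0

open PowerSeries in
theorem residual_truncCoeff {b : ℕ → ℝ} (hb : IsSqrtCoeff b) {n : ℕ} (hn : 3 ≤ n) :
    2 * (1 + X + X ^ 2) * d⁄dX ℝ (PowerSeries.mk (truncCoeff b n)) -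
        (1 + 2 * X) * PowerSeries.mk (truncCoeff b n) =
      C (-2 * (n + 1) * b (n + 1)) * X ^ n + C ((2 * n - 2) * b n) * X ^ (n + 1) := by
  ext k
  obtain _ | _ | k := k
  · rw [coeff_zero_residual]
    simp only [map_add, coeff_C_mul]
    simp [truncCoeff, coeff_X_pow, show ¬ 0 = n by omega, show 1 ≤ n by omega, hb.one]
  · rw [zero_add, coeff_one_residual]
    simp only [map_add, coeff_C_mul]
    simp [truncCoeff, coeff_X_pow, show ¬ n = 0 by omega, show ¬ 1 = n by omega,
      show 1 ≤ n by omega, show 2 ≤ n by omega, hb.two]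
  · rw [show k + 1 + 1 = k + 2 from rfl, coeff_residual]
    simp only [map_add, coeff_C_mul, coeff_X_pow, coeff_mk, truncCoeff]
    have h := hb.step k
    rcases lt_trichotomy n (k + 2) with hlt | rfl | hgt
    · obtain rfl | hlt := Nat.eq_or_lt_of_le (Nat.le_of_lt_succ hlt)
      · simp
        left
        ring
      · simp [show ¬ k + 1 ≤ n by omega, show ¬ k + 2 ≤ n by omega, show ¬ k + 3 ≤ n by omega,
          show k + 2 ≠ n by omega, show k + 2 ≠ n + 1 by omega]
    · simp
      linarith
    · simp [show k + 1 ≤ n by omega, show k + 2 ≤ n by omega, show k + 3 ≤ n by omega,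
        show k + 2 ≠ n by omega, show k + 2 ≠ n + 1 by omega, h]

/-- The recurrence satisfied by the coefficients of `√(1 - z) T_n(z)`, where `A zⁿ + B zⁿ⁺¹` is the
residual of `T_n` in the differential equation of `√(1 + z + z²)`. -/
structure TruncRecurrence (n : ℕ) (A B : ℝ) (d : ℕ → ℝ) : Prop where
  zero : d 0 = 1
  one : d 1 = 0
  two : d 2 = 0
  below {k : ℕ} (hk : k + 3 ≤ n) : 2 * ((k : ℝ) + 3) * d (k + 3) = (2 * k - 3) * d k
  first {k : ℕ} (hk : k + 2 = n) : 2 * ((k : ℝ) + 3) * d (k + 3) = (2 * k - 3) * d k + A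
  second {k : ℕ} (hk : k + 1 = n) :
    2 * ((k : ℝ) + 3) * d (k + 3) = (2 * k - 3) * d k - 3 / 2 * A + B
  above (i : ℕ) : 2 * ((n + i : ℝ) + 3) * d (n + i + 3) = (2 * (n + i) - 3) * d (n + i) +
    A * (sqrtOneSubCoeff (i + 2) - sqrtOneSubCoeff (i + 1)) +
    B * (sqrtOneSubCoeff (i + 1) - sqrtOneSubCoeff i)

open PowerSeries in
theorem derivative_mk_sqrtOneSubCoeff :
    2 * (1 - X) * d⁄dX ℝ (PowerSeries.mk sqrtOneSubCoeff) = -PowerSeries.mk sqrtOneSubCoeff := by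
  set S := PowerSeries.mk sqrtOneSubCoeff
  have h : 2 * (1 - X) * d⁄dX ℝ S =
      d⁄dX ℝ S + d⁄dX ℝ S - X * (d⁄dX ℝ S + d⁄dX ℝ S) := by ring
  rw [h]
  ext k
  have hk := sqrtOneSubCoeff.succ k
  obtain _ | k := k
  · simp only [map_sub, map_add, coeff_zero_X_mul, coeff_derivative, map_neg, S, coeff_mk]
    push_cast at hk ⊢
    linarith
  · simp only [map_sub, map_add, coeff_succ_X_mul, coeff_derivative, map_neg, S, coeff_mk]
    push_cast at hk ⊢
    linarith

open PowerSeries in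
theorem coeff_sqrt_one_sub_cube_residual (G : PowerSeries ℝ) (k : ℕ) :
    coeff (k + 2) (2 * (1 - X ^ 3) * d⁄dX ℝ G + 3 * X ^ 2 * G) =
      2 * (k + 3) * coeff (k + 3) G - (2 * k - 3) * coeff k G := by
  have h : 2 * (1 - X ^ 3) * d⁄dX ℝ G + 3 * X ^ 2 * G = d⁄dX ℝ G + d⁄dX ℝ G +
      X ^ 2 * (G + G + G - X * (d⁄dX ℝ G + d⁄dX ℝ G)) := by ring
  have e (f : PowerSeries ℝ) : coeff (k + 2) (X ^ 2 * f) = coeff k f := coeff_X_pow_mul _ 2 k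
  rw [h, map_add, e]
  obtain _ | k := k
  · simp only [map_sub, map_add, coeff_zero_X_mul, coeff_derivative]
    push_cast
    ring
  · simp only [map_sub, map_add, coeff_succ_X_mul, coeff_derivative]
    push_cast
    ring

open PowerSeries in
theorem truncRecurrence {b : ℕ → ℝ} (hb : IsSqrtCoeff b) {n : ℕ} (hn : 3 ≤ n) :
    TruncRecurrence n (-2 * (n + 1) * b (n + 1)) ((2 * n - 2) * b n) fun k =>
      coeff k (PowerSeries.mk (truncCoeff b n) * PowerSeries.mk sqrtOneSubCoeff) := by
  have hT := residual_truncCoeff hb hn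
  set A := -2 * (n + 1) * b (n + 1)
  set B := (2 * n - 2) * b n
  set T := PowerSeries.mk (truncCoeff b n)
  have hS := derivative_mk_sqrtOneSubCoeff
  set S := PowerSeries.mk sqrtOneSubCoeff
  have hG : 2 * (1 - X ^ 3) * d⁄dX ℝ (T * S) + 3 * X ^ 2 * (T * S) =
      X ^ n * ((1 - X) * S * (C A + C B * X)) := by
    rw [Derivation.leibniz, smul_eq_mul, smul_eq_mul]
    linear_combination (1 - X) * S * hT + (1 + X + X ^ 2) * T * hS
  set R : PowerSeries ℝ := (1 - X) * S * (C A + C B * X) with hR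
  have hR' : R = C A * S + X * (C B * S - C A * S - X * (C B * S)) := by rw [hR]; ring
  have hR0 : coeff 0 R = A := by
    rw [hR']; simp [S, sqrtOneSubCoeff.zero]
  have hR1 : coeff 1 R = -(3 / 2 * A) + B := by
    rw [hR', map_add, show coeff 1 (X * (C B * S - C A * S - X * (C B * S))) = _ from
      coeff_succ_X_mul 0 _]
    simp [S, sqrtOneSubCoeff]
    ring
  have hR2 (i : ℕ) : coeff (i + 2) R =
      A * (sqrtOneSubCoeff (i + 2) - sqrtOneSubCoeff (i + 1)) +
      B * (sqrtOneSubCoeff (i + 1) - sqrtOneSubCoeff i) := by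
    rw [hR', show i + 2 = i + 1 + 1 from rfl, map_add, coeff_succ_X_mul, map_sub, coeff_succ_X_mul]
    simp only [map_sub, coeff_C_mul, S, coeff_mk]
    ring
  have hstep (k : ℕ) : 2 * ((k : ℝ) + 3) * coeff (k + 3) (T * S) =
      (2 * k - 3) * coeff k (T * S) + coeff (k + 2) (X ^ n * R) := by
    rw [← hG, coeff_sqrt_one_sub_cube_residual]
    ring
  have b1 : b 1 = 1 / 2 := by have := hb.one; rw [hb.zero] at this; linarith
  have b2 : b 2 = 3 / 8 := by have := hb.two; rw [hb.zero, b1] at this; linarith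
  have a1 : sqrtOneSubCoeff 1 = -1 / 2 := by norm_num [sqrtOneSubCoeff]
  have a2 : sqrtOneSubCoeff 2 = -1 / 8 := by norm_num [sqrtOneSubCoeff]
  refine ⟨?_, ?_, ?_, fun {k} hk => ?_, fun {k} hk => ?_, fun {k} hk => ?_, fun i => ?_⟩
  · simp [T, S, truncCoeff, hb.zero, sqrtOneSubCoeff.zero]
  · simp only [coeff_mul, T, S, coeff_mk, Nat.antidiagonal_succ, Nat.antidiagonal_zero]
    simp [truncCoeff, hb.zero, sqrtOneSubCoeff.zero, a1, b1, show 1 ≤ n by omega]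
    norm_num
  · simp only [coeff_mul, T, S, coeff_mk, Nat.antidiagonal_succ, Nat.antidiagonal_zero]
    simp [truncCoeff, hb.zero, sqrtOneSubCoeff.zero, a1, a2, b1, b2, show 1 ≤ n by omega,
      show 2 ≤ n by omega]
    norm_num
  · rw [hstep, coeff_X_pow_mul', if_neg (by omega), add_zero]
  · rw [hstep, hk, coeff_X_pow_mul', if_pos le_rfl, Nat.sub_self, hR0]
  · rw [hstep, coeff_X_pow_mul', if_pos (by omega), show k + 2 - n = 1 by omega, hR1]
    ring
  · have := hstep (n + i)
    rw [show n + i + 2 = (i + 2) + n by omega, coeff_X_pow_mul, hR2] at this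
    push_cast at this
    linarith

theorem coeffBlock_bounds_step {m p q : ℝ} (hm : 2 ≤ m) (hp : 0 < p) (hq : 0 < q)
    (h1 : 5 * m * p ≤ 3 * m - 1) (h2 : 3 * p ≤ 4 * m * (p - 3 * q)) {p' q' : ℝ}
    (hp' : (36 * m ^ 2 + 6 * m - 12) * (p' - p) = 6 * p - 3 * q)
    (hq' : (36 * m ^ 2 + 6 * m - 12) * (6 * m + 8) * (q' - q) =
      (18 * m - 6) * p + (126 * m + 93) * q) :
    0 < p' ∧ 0 < q' ∧ 5 * (m + 1) * p' ≤ 3 * (m + 1) - 1 ∧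
      3 * p' ≤ 4 * (m + 1) * (p' - 3 * q') := by
  obtain ⟨t, rfl⟩ : ∃ t, m = t + 2 := ⟨m - 2, by ring⟩
  have ht : 0 ≤ t := by linarith
  set D := 36 * (t + 2) ^ 2 + 6 * (t + 2) - 12 with hD
  have hD0 : 0 < D := by rw [hD]; nlinarith
  have hpq : 3 * q < p := by nlinarith
  have ep : p' = p + (6 * p - 3 * q) / D := by field_simp; linear_combination hp'
  have eq : q' = q + ((18 * (t + 2) - 6) * p + (126 * (t + 2) + 93) * q) /
      (D * (6 * (t + 2) + 8)) := by
    have : 6 * (t + 2) + 8 ≠ 0 := by positivity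
    field_simp; linear_combination hq'
  have hp'0 : 0 < p' := by
    have : 0 < (6 * p - 3 * q) / D := by apply div_pos _ hD0; linarith
    linarith
  have hq'0 : 0 < q' := by
    have : 0 < ((18 * (t + 2) - 6) * p + (126 * (t + 2) + 93) * q) /
      (D * (6 * (t + 2) + 8)) := by
      have : 0 < 18 * (t + 2) - 6 := by linarith
      positivity
    linarith
  refine ⟨hp'0, hq'0, ?_, ?_⟩
  · refine le_of_mul_le_mul_left ?_ (mul_pos hD0 (by linarith : 0 < t + 2))
    have hx : D * p' = (D + 6) * p - 3 * q := by linear_combination hp'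
    have : D * (t + 2) * (5 * (t + 2 + 1) * p') = (t + 3) * ((D + 6) * (5 * (t + 2) * p))
      - 15 * (t + 2) * (t + 3) * q := by linear_combination 5 * (t + 2) * (t + 3) * hx
    rw [this]
    have h3 : (t + 3) * ((D + 6) * (5 * (t + 2) * p)) ≤
        (t + 3) * ((D + 6) * (3 * (t + 2) - 1)) := by gcongr
    have h4 : 0 ≤ 15 * (t + 2) * (t + 3) * q := by positivity
    have h5 : (t + 3) * ((D + 6) * (3 * (t + 2) - 1)) ≤ D * (t + 2) * (3 * (t + 2 + 1) - 1) := by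
      rw [hD]
      nlinarith [mul_nonneg ht ht, mul_nonneg ht (mul_nonneg ht ht)]
    linarith
  · refine le_of_mul_le_mul_left (a := D * (6 * (t + 2) + 8) * (t + 2)) ?_ (by positivity)
    have key : D * (6 * (t + 2) + 8) * (t + 2) * (4 * (t + 2 + 1) * (p' - 3 * q')) -
        D * (6 * (t + 2) + 8) * (t + 2) * (3 * p') =
        (t + 2) * ((4 * t + 9) * (6 * t + 20) * ((D + 6) * p - 3 * q)
        - 12 * (t + 3) * ((18 * t + 30) * p + (D * (6 * t + 20) + 126 * t + 345) * q)) := by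
      linear_combination (t + 2) * (4 * t + 9) * (6 * t + 20) * hp'
        - 12 * (t + 3) * (t + 2) * hq'
    have h3 : 12 * (t + 2) * q ≤ (4 * t + 5) * p := by linarith
    have h4 := mul_le_mul_of_nonneg_left h3
      (show 0 ≤ 3 * (4 * t + 9) * (6 * t + 20) + 12 * (t + 3) * (D * (6 * t + 20) + 126 * t + 345)
        by positivity)
    have h5 : 0 ≤ (12 * (t + 2) * ((4 * t + 9) * (6 * t + 20) * (D + 6)
       - 12 * (t + 3) * (18 * t + 30)) - (3 * (4 * t + 9) * (6 * t + 20) + 12 * (t + 3) *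
        (D * (6 * t + 20) + 126 * t + 345)) * (4 * t + 5)) * p := by
      refine mul_nonneg ?_ hp.le
      rw [hD]
      ring_nf
      positivity
    nlinarith

/-- The size of the coefficients of `√(1 + z + z²)` of index `3 * m`, `3 * m + 1`, `3 * m + 2`, in
units of the `m`-th coefficient of `√(1 - z)`. -/
structure CoeffBlock (b : ℕ → ℝ) (m : ℕ) (p q s : ℝ) : Prop where
  zero : b (3 * m) = sqrtOneSubCoeff m * p
  one : b (3 * m + 1) = -sqrtOneSubCoeff m * q
  two : b (3 * m + 2) = -sqrtOneSubCoeff m * s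
  eq : (6 * m + 4) * s = (6 * m - 2) * p - (6 * m + 1) * q
  p_pos : 0 < p
  q_pos : 0 < q
  p_le : 5 * m * p ≤ 3 * m - 1
  q_le : (18 * m + 1) * q ≤ (6 * m - 2) * p

theorem CoeffBlock.succ {b : ℕ → ℝ} (hb : IsSqrtCoeff b) {m : ℕ} (hm : 1 ≤ m) {p q s : ℝ}
    (h : CoeffBlock b m p q s) {p' q' : ℝ}
    (hp' : (36 * (m : ℝ) ^ 2 + 6 * m - 12) * (p' - p) = 6 * p - 3 * q)
    (hq' : (36 * (m : ℝ) ^ 2 + 6 * m - 12) * (6 * m + 8) * (q' - q) =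
      (18 * m - 6) * p + (126 * m + 93) * q)
    (p_pos : 0 < p') (q_pos : 0 < q') (p_le : 5 * (m + 1) * p' ≤ 3 * (m + 1) - 1)
    (q_le : (18 * (m + 1) + 1) * q' ≤ (6 * (m + 1) - 2) * p') :
    ∃ s', CoeffBlock b (m + 1) p' q' s' := by
  have hm1 : (1 : ℝ) ≤ m := by exact_mod_cast hm
  have ha := sqrtOneSubCoeff.succ m
  have r0 := hb.step (3 * m)
  have r1 := hb.step (3 * m + 1)
  have r2 := hb.step (3 * m + 2)
  have e := h.eq
  rw [h.one, h.two] at r0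
  rw [show 3 * m + 1 + 1 = 3 * m + 2 from rfl, show 3 * m + 1 + 2 = 3 * m + 3 from rfl,
    h.two] at r1
  push_cast at r0 r1 r2
  set α := sqrtOneSubCoeff m
  set α' := sqrtOneSubCoeff (m + 1)
  have n1 : 6 * (m : ℝ) + 4 ≠ 0 := by positivity
  have n2 : 2 * (m : ℝ) - 1 ≠ 0 := by linarith
  have n3 : 6 * (m : ℝ) + 8 ≠ 0 := by positivity
  have n4 : 6 * (m : ℝ) + 6 ≠ 0 := by positivity
  have n5 : 6 * (m : ℝ) + 10 ≠ 0 := by positivity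
  have ep : 3 * (2 * m - 1) * p' = (6 * m + 3) * s + 6 * m * q := by
    refine mul_left_cancel₀ n1 ?_
    linear_combination hp' - (6 * m + 3) * e
  have z' : b (3 * m + 3) = α' * p' := by
    refine mul_left_cancel₀ n4 ?_
    linear_combination r0 - α * ep - 3 * p' * ha
  have eq' : (2 * m - 1) * (6 * m + 8) * q' =
      (2 * m - 1) * (6 * m + 5) * p' - (6 * m + 2) * (2 * m + 2) * s := by
    refine mul_left_cancel₀ n1 ?_
    refine mul_left_cancel₀ three_ne_zero ?_
    linear_combination hq' - (6 * m + 5) * hp' + 3 * (6 * m + 2) * (2 * m + 2) * e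
  have o' : b (3 * m + 4) = -α' * q' := by
    refine mul_left_cancel₀ (mul_ne_zero n2 n3) ?_
    linear_combination (2 * m - 1) * r1 - (2 * m - 1) * (6 * m + 5) * z' + α' * eq'
      - (6 * m + 2) * s * ha
  refine ⟨((6 * (m + 1) - 2) * p' - (6 * (m + 1) + 1) * q') / (6 * m + 10),
    z', o', ?_, ?_, p_pos, q_pos, by push_cast; exact p_le, by push_cast; exact q_le⟩
  · rw [show 3 * m + 2 + 3 = 3 * (m + 1) + 2 by ring, show 3 * m + 2 + 2 = 3 * m + 4 from rfl,
      show 3 * m + 2 + 1 = 3 * m + 3 from rfl, o', z'] at r2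
    rw [mul_div_assoc', eq_div_iff n5]
    linear_combination r2
  · push_cast
    field_simp
    ring

theorem exists_coeffBlock {b : ℕ → ℝ} (hb : IsSqrtCoeff b) {m : ℕ} (hm : 1 ≤ m) :
    ∃ p q s, CoeffBlock b m p q s := by
  have b1 : b 1 = 1 / 2 := by have := hb.one; rw [hb.zero] at this; linarith
  have b2 : b 2 = 3 / 8 := by have := hb.two; rw [hb.zero, b1] at this; linarith
  have b3 : b 3 = -3 / 16 := by have := hb.step 0; norm_num [b1, b2] at this; linarith
  have b4 : b 4 = 3 / 128 := by have := hb.step 1; norm_num [b3, b2] at this; linarith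
  have b5 : b 5 = 15 / 256 := by have := hb.step 2; norm_num [b3, b4] at this; linarith
  have a1 : sqrtOneSubCoeff 1 = -1 / 2 := by norm_num [sqrtOneSubCoeff]
  have h1 : CoeffBlock b 1 (3 / 8) (3 / 64) (15 / 128) := by
    constructor <;> norm_num [a1, b3, b4, b5]
  obtain rfl | hm2 := Nat.eq_or_lt_of_le hm
  · exact ⟨_, _, _, h1⟩
  suffices ∃ p q s, CoeffBlock b m p q s ∧ 3 * p ≤ 4 * m * (p - 3 * q) by
    obtain ⟨p, q, s, h, -⟩ := this
    exact ⟨p, q, s, h⟩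
  induction m, hm2 using Nat.le_induction with
  | base =>
    obtain ⟨s, hs⟩ := h1.succ hb le_rfl (p' := 57 / 128) (q' := 21 / 256)
      (by norm_num) (by norm_num) (by norm_num) (by norm_num) (by norm_num) (by norm_num)
    exact ⟨_, _, s, hs, by norm_num⟩
  | succ m hmle ih =>
    obtain ⟨p, q, s, h, hpq⟩ := ih (by omega)
    have hm2 : (2 : ℝ) ≤ m := by exact_mod_cast hmle
    have hD : 36 * (m : ℝ) ^ 2 + 6 * m - 12 ≠ 0 := by nlinarith
    have hE : 6 * (m : ℝ) + 8 ≠ 0 := by positivity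
    have hsolve (D x c : ℝ) (hD : D ≠ 0) : ∃ y, D * (y - x) = c :=
      ⟨x + c / D, by field_simp; ring⟩
    obtain ⟨p', hp'⟩ := hsolve _ p (6 * p - 3 * q) hD
    obtain ⟨q', hq'⟩ := hsolve _ q ((18 * m - 6) * p + (126 * m + 93) * q) (mul_ne_zero hD hE)
    obtain ⟨p_pos, q_pos, p_le, hpq'⟩ :=
      coeffBlock_bounds_step hm2 h.p_pos h.q_pos h.p_le hpq hp' hq'
    obtain ⟨s', hs'⟩ := h.succ hb (by omega) hp' hq' p_pos q_pos p_le (by nlinarith)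
    exact ⟨p', q', s', hs', by push_cast; exact hpq'⟩

namespace CoeffBlock

variable {b : ℕ → ℝ} {m : ℕ} {p q s : ℝ}

theorem s_pos (h : CoeffBlock b m p q s) (hm : 1 ≤ m) : 0 < s := by
  have hm1 : (1 : ℝ) ≤ m := by exact_mod_cast hm
  have := h.eq
  have := h.q_le
  have : 0 < (m : ℝ) * q := mul_pos (by linarith) h.q_pos
  have : 0 < (6 * (m : ℝ) + 4) * s := by linarith
  exact pos_of_mul_pos_right this (by positivity)

theorem zero_neg (h : CoeffBlock b m p q s) (hm : 1 ≤ m) : b (3 * m) < 0 := by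
  rw [h.zero]
  exact mul_neg_of_neg_of_pos (sqrtOneSubCoeff.neg_of_pos hm) h.p_pos

theorem one_pos (h : CoeffBlock b m p q s) (hm : 1 ≤ m) : 0 < b (3 * m + 1) := by
  rw [h.one]
  exact mul_pos (neg_pos.2 (sqrtOneSubCoeff.neg_of_pos hm)) h.q_pos

theorem two_pos (h : CoeffBlock b m p q s) (hm : 1 ≤ m) : 0 < b (3 * m + 2) := by
  rw [h.two]
  exact mul_pos (neg_pos.2 (sqrtOneSubCoeff.neg_of_pos hm)) (h.s_pos hm)

theorem p_lt (h : CoeffBlock b m p q s) (hm : 1 ≤ m) : p < 3 / 5 := by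
  have hm1 : (1 : ℝ) ≤ m := by exact_mod_cast hm
  have := h.p_le
  by_contra! hp
  nlinarith

theorem mul_p_le (h : CoeffBlock b m p q s) (hm : 1 ≤ m) : (9 * m - 3) * p ≤ 6 * m - 3 := by
  have hm1 : (1 : ℝ) ≤ m := by exact_mod_cast hm
  have h1 := h.p_le
  have : (m : ℝ) * ((9 * m - 3) * p) ≤ m * (6 * m - 3) := by nlinarith
  exact le_of_mul_le_mul_left this (by linarith)

end CoeffBlock

theorem sum_range_pos_of_isSqrtCoeff {b : ℕ → ℝ} (hb : IsSqrtCoeff b) (n : ℕ) :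
    0 < ∑ k ∈ range (n + 1), b k := by
  have b1 : b 1 = 1 / 2 := by have := hb.one; rw [hb.zero] at this; linarith
  have b2 : b 2 = 3 / 8 := by have := hb.two; rw [hb.zero, b1] at this; linarith
  have key (m : ℕ) :
      3 / 5 * ∑ k ∈ range (m + 1), sqrtOneSubCoeff k < ∑ k ∈ range (3 * m + 1), b k ∧
      0 < b (3 * m + 1) ∧ 0 < b (3 * m + 2) := by
    induction m with
    | zero => norm_num [b1, b2, sqrtOneSubCoeff.zero, hb.zero]
    | succ m ih =>
      obtain ⟨p, q, s, h⟩ := exists_coeffBlock hb (Nat.le_add_left 1 m)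
      refine ⟨?_, h.one_pos (by omega), h.two_pos (by omega)⟩
      have hsum : ∑ k ∈ range (3 * (m + 1) + 1), b k =
          ∑ k ∈ range (3 * m + 1), b k + b (3 * m + 1) + b (3 * m + 2) + b (3 * (m + 1)) := by
        rw [show 3 * (m + 1) + 1 = 3 * m + 1 + 1 + 1 + 1 by ring, sum_range_succ,
          sum_range_succ, sum_range_succ]
        rfl
      rw [sum_range_succ, hsum, h.zero]
      have := h.p_lt (by omega)
      have := sqrtOneSubCoeff.succ_neg m
      have := ih.2.1
      have := ih.2.2
      have := ih.1
      nlinarith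
  obtain ⟨h0, h1, h2⟩ := key (n / 3)
  have hpos := sqrtOneSubCoeff.sum_range_pos (n / 3)
  have hn : n = 3 * (n / 3) ∨ n = 3 * (n / 3) + 1 ∨ n = 3 * (n / 3) + 2 := by omega
  obtain hn | hn | hn := hn <;> rw [hn]
  · linarith
  · rw [sum_range_succ]
    linarith
  · rw [sum_range_succ, sum_range_succ]
    linarith

namespace TruncRecurrence

variable {n : ℕ} {A B : ℝ} {d : ℕ → ℝ}

theorem eq_sqrtOneSubCoeff (h : TruncRecurrence n A B d) {j : ℕ} (hj : 3 * j ≤ n) :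
    d (3 * j) = sqrtOneSubCoeff j := by
  induction j with
  | zero => exact h.zero
  | succ j ih =>
    have h1 := h.below (k := 3 * j) (by omega)
    rw [ih (by omega)] at h1
    have h2 := sqrtOneSubCoeff.succ j
    have : 6 * ((j : ℝ) + 1) ≠ 0 := by positivity
    refine mul_left_cancel₀ this ?_
    push_cast at h1
    rw [show 3 * (j + 1) = 3 * j + 3 by ring]
    linear_combination h1 - 3 * h2

theorem eq_zero_one (h : TruncRecurrence n A B d) {j : ℕ} (hj : 3 * j + 1 ≤ n) :
    d (3 * j + 1) = 0 := by
  induction j with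
  | zero => exact h.one
  | succ j ih =>
    have h1 := h.below (k := 3 * j + 1) (by omega)
    rw [ih (by omega), mul_zero] at h1
    exact (mul_eq_zero.1 h1).resolve_left (by positivity)

theorem eq_zero_two (h : TruncRecurrence n A B d) {j : ℕ} (hj : 3 * j + 2 ≤ n) :
    d (3 * j + 2) = 0 := by
  induction j with
  | zero => exact h.two
  | succ j ih =>
    have h1 := h.below (k := 3 * j + 2) (by omega)
    rw [ih (by omega), mul_zero] at h1
    exact (mul_eq_zero.1 h1).resolve_left (by positivity)

theorem nonpos_of_le (h : TruncRecurrence n A B d) {k : ℕ} (hk : 1 ≤ k) (hkn : k ≤ n) :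
    d k ≤ 0 := by
  have : k = 3 * (k / 3) ∨ k = 3 * (k / 3) + 1 ∨ k = 3 * (k / 3) + 2 := by omega
  obtain hj | hj | hj := this <;> rw [hj]
  · rw [h.eq_sqrtOneSubCoeff (by omega)]
    exact (sqrtOneSubCoeff.neg_of_pos (by omega)).le
  · exact (h.eq_zero_one (by omega)).le
  · exact (h.eq_zero_two (by omega)).le

theorem three_neg (h : TruncRecurrence n A B d) (hn : 3 ≤ n) : d 3 < 0 := by
  rw [show 3 = 3 * 1 from rfl, h.eq_sqrtOneSubCoeff (by omega)]
  exact sqrtOneSubCoeff.succ_neg 0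

/-- Once the coefficients up to index `n + i₀ + 2` are nonpositive, all of them are, provided the
forcing term of the recurrence stays nonpositive. -/
theorem nonpos_of_forcing_nonpos (h : TruncRecurrence n A B d) (hn : 3 ≤ n) {i₀ : ℕ}
    (hinit : ∀ i < i₀ + 3, d (n + i) ≤ 0)
    (hforce : ∀ i, i₀ ≤ i → A * (sqrtOneSubCoeff (i + 2) - sqrtOneSubCoeff (i + 1)) +
      B * (sqrtOneSubCoeff (i + 1) - sqrtOneSubCoeff i) ≤ 0) {k : ℕ} (hk : 1 ≤ k) : d k ≤ 0 := by
  obtain hkn | hkn := le_or_gt k n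
  · exact h.nonpos_of_le hk hkn
  obtain ⟨i, rfl⟩ := Nat.exists_eq_add_of_le hkn.le
  clear hk hkn
  induction i using Nat.strong_induction_on with
  | _ i ih =>
    obtain hi | hi := lt_or_ge i (i₀ + 3)
    · exact hinit i hi
    obtain ⟨j, rfl⟩ := Nat.exists_eq_add_of_le' (show 3 ≤ i by omega)
    have h1 := h.above j
    have h2 := ih j (by omega)
    have h3 := hforce j (by omega)
    have hn' : (3 : ℝ) ≤ n := by exact_mod_cast hn
    have hj : (0 : ℝ) ≤ j := j.cast_nonneg
    have h4 : (2 * ((n : ℝ) + j) - 3) * d (n + j) ≤ 0 :=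
      mul_nonpos_of_nonneg_of_nonpos (by linarith) h2
    rw [← add_assoc]
    refine nonpos_of_mul_nonpos_right (a := 2 * ((n + j : ℝ) + 3)) ?_ (by positivity)
    linarith

/-- If the forcing term of the recurrence is nonnegative, nonpositivity propagates downwards. -/
theorem nonpos_of_eventually_nonpos (h : TruncRecurrence n A B d) (hn : 3 ≤ n)
    (hA : 0 ≤ A) (hB : 0 ≤ B) (hev : ∀ᶠ k in Filter.atTop, d k ≤ 0) {k : ℕ} (hk : 1 ≤ k) :
    d k ≤ 0 := by
  obtain hkn | hkn := le_or_gt k n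
  · exact h.nonpos_of_le hk hkn
  obtain ⟨K, hK⟩ := Filter.eventually_atTop.1 hev
  have hback (k : ℕ) (hk : n < k) (h3 : d (k + 3) ≤ 0) : d k ≤ 0 := by
    obtain ⟨i, rfl⟩ := Nat.exists_eq_add_of_lt hk
    rw [add_assoc n i 1] at h3 ⊢
    have h1 := h.above (i + 1)
    have g1 := mul_nonneg hA (sqrtOneSubCoeff.sub_nonneg (i + 1))
    have g2 := mul_nonneg hB (sqrtOneSubCoeff.sub_nonneg i)
    have hn' : (3 : ℝ) ≤ n := by exact_mod_cast hn
    have hi : (0 : ℝ) ≤ i := i.cast_nonneg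
    push_cast at h1
    have h4 : 2 * ((n : ℝ) + (i + 1) + 3) * d (n + (i + 1) + 3) ≤ 0 :=
      mul_nonpos_of_nonneg_of_nonpos (by positivity) h3
    refine nonpos_of_mul_nonpos_right (a := 2 * ((n : ℝ) + (i + 1)) - 3) ?_ (by linarith)
    linarith
  have hall (t : ℕ) : ∀ k, n < k → K ≤ k + 3 * t → d k ≤ 0 := by
    induction t with
    | zero => exact fun k _ hk => hK k hk
    | succ t ih => exact fun k hk hk' => hback k hk (ih (k + 3) (by omega) (by omega))
  exact hall K k hkn (by omega)

end TruncRecurrence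

open PowerSeries in
theorem eventually_coeff_trunc_mul_neg {b : ℕ → ℝ} {n : ℕ} (h : 0 < ∑ k ∈ range (n + 1), b k) :
    ∀ᶠ k in Filter.atTop,
      coeff k (PowerSeries.mk (truncCoeff b n) * PowerSeries.mk sqrtOneSubCoeff) < 0 := by
  have hlim : Filter.Tendsto
      (fun k => ∑ j ∈ range (n + 1),
        b (n - j) * (sqrtOneSubCoeff (k + 1 + j) / sqrtOneSubCoeff (k + 1)))
      Filter.atTop (nhds (∑ j ∈ range (n + 1), b (n - j) * 1)) := by
    refine tendsto_finsetSum _ fun j _ => Filter.Tendsto.const_mul _ ?_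
    have := (sqrtOneSubCoeff.tendsto_ratio j).inv₀ one_ne_zero
    simpa using this
  have hsum : ∑ j ∈ range (n + 1), b (n - j) * 1 = ∑ k ∈ range (n + 1), b k := by
    simp only [mul_one]
    exact sum_range_reflect b (n + 1)
  rw [hsum] at hlim
  have hev := hlim.eventually_const_lt h
  rw [← Filter.map_add_atTop_eq_nat (n + 1), Filter.eventually_map]
  filter_upwards [hev] with k hk
  have hneg := sqrtOneSubCoeff.succ_neg k
  have : coeff (k + (n + 1)) (PowerSeries.mk (truncCoeff b n) * PowerSeries.mk sqrtOneSubCoeff) =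
      sqrtOneSubCoeff (k + 1) * ∑ j ∈ range (n + 1),
        b (n - j) * (sqrtOneSubCoeff (k + 1 + j) / sqrtOneSubCoeff (k + 1)) := by
    rw [coeff_mul, Nat.sum_antidiagonal_eq_sum_range_succ_mk, mul_sum,
      ← sum_range_reflect _ (n + 1)]
    symm
    refine sum_subset_zero_on_sdiff (range_subset_range.2 (by omega)) ?_ ?_
    · intro j hj
      have : ¬ j ≤ n := by simp at hj; omega
      simp [truncCoeff, this]
    · intro j hj
      have : j ≤ n := by simp at hj; omega
      simp only [coeff_mk, truncCoeff, if_pos this]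
      rw [show n - (n + 1 - 1 - j) = j by omega,
        show k + 1 + (n + 1 - 1 - j) = k + (n + 1) - j by omega]
      have hne := hneg.ne
      field_simp
  rw [this]
  exact mul_neg_of_neg_of_pos hneg hk

namespace CoeffBlock

variable {b : ℕ → ℝ} {m : ℕ} {p q s : ℝ} {d : ℕ → ℝ}

theorem truncRecurrence_three_mul (hc : CoeffBlock b m p q s) (hm : 1 ≤ m) {n : ℕ}
    (hn : n = 3 * m) (h : TruncRecurrence n (-2 * (n + 1) * b (n + 1)) ((2 * n - 2) * b n) d) :
    (∀ k, 1 ≤ k → d k ≤ 0) ∧ d (n + 1) < 0 := by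
  have hm1 : (1 : ℝ) ≤ m := by exact_mod_cast hm
  have hnR : (n : ℝ) = 3 * m := by rw [hn]; push_cast; ring
  have hα := sqrtOneSubCoeff.neg_of_pos hm
  have h1 := hc.one_pos hm
  have h0 := hc.zero_neg hm
  set A := -2 * (n + 1) * b (n + 1) with hAdef
  set B := (2 * n - 2) * b n with hBdef
  have hA : A < 0 := by
    rw [hAdef, hn]
    have : (0 : ℝ) ≤ (3 * m : ℕ) := Nat.cast_nonneg _
    nlinarith
  have hB : B < 0 := by
    rw [hBdef, hnR, hn]
    exact mul_neg_of_pos_of_neg (by linarith) h0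
  have hA' : A = 2 * (3 * m + 1) * (sqrtOneSubCoeff m * q) := by
    rw [hAdef, hnR, hn, hc.one]; ring
  have hB' : B = (6 * m - 2) * (sqrtOneSubCoeff m * p) := by rw [hBdef, hnR, hn, hc.zero]; ring
  have d1 : d (n + 1) < 0 := by
    have := h.first (k := 3 * (m - 1) + 1) (by omega)
    rw [h.eq_zero_one (by omega), mul_zero, zero_add,
      show 3 * (m - 1) + 1 + 3 = n + 1 by omega] at this
    exact neg_of_mul_neg_right (this.trans_lt hA) (by positivity)
  have d2 : d (n + 2) ≤ 0 := by
    have := h.second (k := 3 * (m - 1) + 2) (by omega)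
    rw [h.eq_zero_two (by omega), mul_zero,
      show 3 * (m - 1) + 2 + 3 = n + 2 by omega] at this
    refine nonpos_of_mul_nonpos_right (this.trans_le ?_) (by positivity)
    have hq : 0 ≤ (6 * m - 2) * p - 3 * (3 * m + 1) * q := by nlinarith [hc.q_le, hc.q_pos]
    rw [hA', hB']
    nlinarith
  have d3 : d (n + 3) ≤ 0 := by
    have := h.above 0
    have hd : d n = sqrtOneSubCoeff m := by rw [hn]; exact h.eq_sqrtOneSubCoeff hn.ge
    norm_num [sqrtOneSubCoeff, hd] at this
    refine nonpos_of_mul_nonpos_right (this.trans_le ?_) (by positivity)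
    have hq : 0 ≤ (6 * m - 3) - (9 * m - 3) * p + 3 / 4 * (3 * m + 1) * q := by
      have := hc.mul_p_le hm
      have := hc.q_pos
      have : 0 ≤ 3 / 4 * (3 * (m : ℝ) + 1) * q := by positivity
      linarith
    rw [hA', hB', hnR]
    nlinarith
  refine ⟨fun k hk => h.nonpos_of_forcing_nonpos (by omega) (i₀ := 1) (fun i hi => ?_)
    (fun i hi => ?_) hk, d1⟩
  · interval_cases i
    exacts [h.nonpos_of_le (by omega) le_rfl, d1.le, d2, d3]
  · obtain ⟨j, rfl⟩ := Nat.exists_eq_add_of_le' hi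
    have g1 := sqrtOneSubCoeff.sub_nonneg (j + 1)
    have g2 := sqrtOneSubCoeff.sub_nonneg j
    exact add_nonpos (mul_nonpos_of_nonpos_of_nonneg hA.le g1)
      (mul_nonpos_of_nonpos_of_nonneg hB.le g2)

theorem truncRecurrence_three_mul_add_one (hc : CoeffBlock b m p q s) (hm : 1 ≤ m) {n : ℕ}
    (hn : n = 3 * m + 1)
    (h : TruncRecurrence n (-2 * (n + 1) * b (n + 1)) ((2 * n - 2) * b n) d) :
    (∀ k, 1 ≤ k → d k ≤ 0) ∧ d (n + 1) < 0 := by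
  have hm1 : (1 : ℝ) ≤ m := by exact_mod_cast hm
  have hnR : (n : ℝ) = 3 * m + 1 := by rw [hn]; push_cast; ring
  have hα := sqrtOneSubCoeff.neg_of_pos hm
  have hq := hc.q_pos
  have hs := hc.s_pos hm
  have he := hc.eq
  have hmq : 0 < (m : ℝ) * q := by positivity
  have hsq : 12 * (m * q) ≤ (6 * m + 4) * s := by linarith [hc.q_le]
  have hmp := hc.mul_p_le hm
  set A := -2 * (n + 1) * b (n + 1) with hAdef
  set B := (2 * n - 2) * b n with hBdef
  set α := sqrtOneSubCoeff m with hαdef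
  have hA' : A = α * ((6 * m + 4) * s) := by
    rw [hAdef, hnR, hn, show 3 * m + 1 + 1 = 3 * m + 2 from rfl, hc.two]; ring
  have hB' : B = -α * (6 * (m * q)) := by rw [hBdef, hnR, hn, hc.one]; ring
  have hA : A < 0 := by rw [hA']; exact mul_neg_of_neg_of_pos hα (by positivity)
  have hB : 0 < B := by rw [hB']; exact mul_pos (neg_pos.2 hα) (by positivity)
  have hAB : A + 2 * B ≤ 0 := by rw [hA', hB']; nlinarith
  have d1' : 2 * (n + 1) * d (n + 1) = A := by
    have := h.first (k := 3 * (m - 1) + 2) (by omega)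
    rw [h.eq_zero_two (by omega), mul_zero, zero_add,
      show 3 * (m - 1) + 2 + 3 = n + 1 by omega] at this
    rw [← this, hnR, Nat.cast_add, Nat.cast_mul, Nat.cast_sub hm]
    push_cast
    ring
  have d1 : d (n + 1) < 0 := neg_of_mul_neg_right (d1'.trans_lt hA) (by positivity)
  have d2' : 2 * (n + 2) * d (n + 2) ≤ α * (3 * (m * q)) := by
    have := h.second (k := 3 * m) (by omega)
    rw [h.eq_sqrtOneSubCoeff (by omega), show 3 * m + 3 = n + 2 by omega, hA', hB', he] at this
    push_cast at this
    rw [hnR, show 2 * (3 * (m : ℝ) + 1 + 2) = 2 * (3 * m + 3) by ring, this, ← hαdef]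
    have h0 : 0 ≤ 6 * m - 3 - (9 * m - 3) * p + 3 / 2 * q := by linarith
    nlinarith [mul_nonneg (neg_nonneg.2 hα.le) h0]
  have d2 : d (n + 2) ≤ 0 :=
    nonpos_of_mul_nonpos_right (d2'.trans (mul_nonpos_of_nonpos_of_nonneg hα.le (by positivity)))
      (by positivity)
  have d3 : d (n + 3) ≤ 0 := by
    have := h.above 0
    have hd : d n = 0 := by rw [hn]; exact h.eq_zero_one hn.ge
    norm_num [sqrtOneSubCoeff, hd] at this
    refine nonpos_of_mul_nonpos_right (this.trans_le ?_) (by positivity)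
    linarith
  have d4 : d (n + 4) ≤ 0 := by
    have := h.above 1
    norm_num [sqrtOneSubCoeff] at this
    refine nonpos_of_mul_nonpos_right (this.trans_le ?_) (by positivity)
    have : (2 * ((n : ℝ) + 1) - 3) * d (n + 1) ≤ (n + 1) * d (n + 1) := by nlinarith
    linarith
  have d5 : d (n + 5) ≤ 0 := by
    have := h.above 2
    norm_num [sqrtOneSubCoeff] at this
    refine nonpos_of_mul_nonpos_right (this.trans_le ?_) (by positivity)
    have : (2 * ((n : ℝ) + 2) - 3) * d (n + 2) ≤ (n + 2) * d (n + 2) := by nlinarith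
    have : α * (3 * (m * q)) ≤ -B / 2 := by rw [hB']; linarith
    linarith
  refine ⟨fun k hk => h.nonpos_of_forcing_nonpos (by omega) (i₀ := 3) (fun i hi => ?_)
    (fun i hi => ?_) hk, d1⟩
  · interval_cases i
    exacts [h.nonpos_of_le (by omega) le_rfl, d1.le, d2, d3, d4, d5]
  · obtain ⟨j, rfl⟩ := Nat.exists_eq_add_of_le' hi
    have g1 := sqrtOneSubCoeff.sub_nonneg (j + 3)
    have g2 := sqrtOneSubCoeff.sub_le j
    rw [show j + 3 + 2 = j + 5 from rfl, show j + 3 + 1 = j + 4 from rfl] at g1 ⊢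
    nlinarith

end CoeffBlock

open PowerSeries in
theorem coeff_trunc_mul_nonpos {b : ℕ → ℝ} (hb : IsSqrtCoeff b) {n : ℕ} (hn : 3 ≤ n) {d : ℕ → ℝ}
    (hd : d = fun k =>
      coeff k (PowerSeries.mk (truncCoeff b n) * PowerSeries.mk sqrtOneSubCoeff)) :
    (∀ k, 1 ≤ k → d k ≤ 0) ∧ ∃ k, ¬ 3 ∣ k ∧ d k < 0 := by
  have h := truncRecurrence hb hn
  rw [← hd] at h
  obtain ⟨m, hm, hnm⟩ : ∃ m, 1 ≤ m ∧ (n = 3 * m ∨ n = 3 * m + 1 ∨ n = 3 * m + 2) :=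
    ⟨n / 3, by omega, by omega⟩
  obtain ⟨p, q, s, hc⟩ := exists_coeffBlock hb hm
  obtain hnm | hnm | hnm := hnm
  · obtain ⟨h1, h2⟩ := hc.truncRecurrence_three_mul hm hnm h
    exact ⟨h1, n + 1, by omega, h2⟩
  · obtain ⟨h1, h2⟩ := hc.truncRecurrence_three_mul_add_one hm hnm h
    exact ⟨h1, n + 1, by omega, h2⟩
  · obtain ⟨p', q', s', hc'⟩ := exists_coeffBlock hb (Nat.le_add_left 1 m)
    have hnR : (n : ℝ) = 3 * m + 2 := by rw [hnm]; push_cast; ring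
    have hmR : (0 : ℝ) ≤ m := m.cast_nonneg
    have h3 := hc'.zero_neg (by omega)
    have h2 := hc.two_pos hm
    have h1 := hc.one_pos hm
    rw [show 3 * (m + 1) = 3 * m + 3 by ring] at h3
    have hA : 0 ≤ -2 * ((n : ℝ) + 1) * b (n + 1) := by
      rw [hnR, hnm, show 3 * m + 2 + 1 = 3 * m + 3 from rfl]
      nlinarith
    have hB : 0 ≤ (2 * (n : ℝ) - 2) * b n := by
      rw [hnR, hnm]
      exact mul_nonneg (by linarith) h2.le
    refine ⟨fun k hk => h.nonpos_of_eventually_nonpos hn hA hB ?_ hk, n + 2, by omega, ?_⟩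
    · rw [hd]
      exact (eventually_coeff_trunc_mul_neg (sum_range_pos_of_isSqrtCoeff hb n)).mono
        fun _ hk => hk.le
    · have := h.second (k := 3 * m + 1) (by omega)
      rw [h.eq_zero_one (by omega), mul_zero, show 3 * m + 1 + 3 = n + 2 by omega] at this
      refine neg_of_mul_neg_right (this.trans_lt ?_) (by positivity)
      have hr := hb.step (3 * m)
      push_cast at hr
      rw [hnR, hnm, show 3 * m + 2 + 1 = 3 * m + 3 from rfl]
      have : 0 ≤ (m : ℝ) * b (3 * m + 1) := by positivity
      have : 0 ≤ (m : ℝ) * b (3 * m + 2) := by positivity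
      linarith

theorem eq_one_of_pow_three_eq_one {z : ℂ} {k : ℕ} (hk : ¬ 3 ∣ k) (h3 : z ^ 3 = 1)
    (h : z ^ k = 1) : z = 1 := by
  have h1 := orderOf_dvd_of_pow_eq_one h3
  have h2 := orderOf_dvd_of_pow_eq_one h
  obtain h0 | h0 := (Nat.dvd_prime Nat.prime_three).1 h1
  · exact orderOf_eq_one_iff.1 h0
  · exact absurd (h0 ▸ h2) hk

theorem eq_one_of_re_eq_one {w : ℂ} (hw : ‖w‖ ≤ 1) (h : w.re = 1) : w = 1 := by
  have h1 := Complex.sq_norm w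
  rw [Complex.normSq_apply, h] at h1
  have : w.im = 0 := by nlinarith [norm_nonneg w, sq_nonneg w.im]
  exact Complex.ext h this

/-- A power series `1 - ∑ |d k| z ^ k` with nonnegative sum at `1` can only vanish in the closed
unit disk at points where all the monomials that occur are equal to `1`. -/
theorem eq_one_of_hasSum_zero {d : ℕ → ℝ} (hs : Summable d) (hd : ∀ k, 1 ≤ k → d k ≤ 0)
    (hsum : 0 ≤ ∑' k, d k) {z : ℂ} (hz : ‖z‖ ≤ 1) (h : HasSum (fun k => (d k : ℂ) * z ^ k) 0)
    {k : ℕ} (hk : d k < 0) : z ^ k = 1 := by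
  have hpow (k : ℕ) : ‖z ^ k‖ ≤ 1 := by
    rw [norm_pow]; exact pow_le_one₀ (norm_nonneg _) hz
  have hre : HasSum (fun k => d k * (z ^ k).re) 0 := by
    simpa using Complex.hasSum_re h
  have hdiff := hre.sub hs.hasSum
  have hnonneg (k : ℕ) : 0 ≤ d k * (z ^ k).re - d k := by
    obtain rfl | h0 := Nat.eq_zero_or_pos k
    · simp
    · have h1 := hd k h0
      have h2 := (Complex.re_le_norm (z ^ k)).trans (hpow k)
      nlinarith
  have hzero : (0 : ℝ) - ∑' k, d k = 0 :=
    le_antisymm (by linarith) (hdiff.nonneg hnonneg)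
  rw [hzero, hasSum_zero_iff_of_nonneg hnonneg] at hdiff
  have h1 := congrFun hdiff k
  simp only [Pi.zero_apply] at h1
  refine eq_one_of_re_eq_one (hpow k) (mul_left_cancel₀ hk.ne ?_)
  linarith

theorem hasSum_truncCoeff (b : ℕ → ℝ) (n : ℕ) (z : ℂ) :
    HasSum (fun k => (truncCoeff b n k : ℂ) * z ^ k)
      (∑ k ∈ range (n + 1), (b k : ℂ) * z ^ k) := by
  have : ∑ k ∈ range (n + 1), (b k : ℂ) * z ^ k =
      ∑ k ∈ range (n + 1), (truncCoeff b n k : ℂ) * z ^ k :=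
    sum_congr rfl fun k hk => by
      rw [truncCoeff, if_pos (Nat.le_of_lt_succ (mem_range.1 hk))]
  rw [this]
  refine hasSum_sum_of_ne_finset_zero fun k hk => ?_
  have : ¬ k ≤ n := fun h => hk (mem_range.2 (Nat.lt_succ_of_le h))
  simp [truncCoeff, this]

open PowerSeries in
theorem hasSum_coeff_trunc_mul (b : ℕ → ℝ) (n : ℕ) {z : ℂ} (hz : ‖z‖ ≤ 1) :
    HasSum (fun k => ((coeff k (PowerSeries.mk (truncCoeff b n) *
        PowerSeries.mk sqrtOneSubCoeff) : ℝ) : ℂ) * z ^ k)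
      ((∑ k ∈ range (n + 1), (b k : ℂ) * z ^ k) * ∑' k, (sqrtOneSubCoeff k : ℂ) * z ^ k) := by
  have hT := hasSum_truncCoeff b n z
  have hTn : Summable fun k => ‖(truncCoeff b n k : ℂ) * z ^ k‖ := hT.summable.norm
  have hSn : Summable fun k => ‖(sqrtOneSubCoeff k : ℂ) * z ^ k‖ := by
    refine Summable.of_nonneg_of_le (fun _ => norm_nonneg _) (fun k => ?_)
      sqrtOneSubCoeff.summable.abs
    rw [norm_mul, norm_pow, Complex.norm_real, Real.norm_eq_abs]
    exact mul_le_of_le_one_right (abs_nonneg _) (pow_le_one₀ (norm_nonneg _) hz)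
  have h1 := tsum_mul_tsum_eq_tsum_sum_antidiagonal_of_summable_norm hTn hSn
  have h2 := (summable_norm_sum_mul_antidiagonal_of_summable_norm hTn hSn).of_norm.hasSum
  rw [← h1, hT.tsum_eq] at h2
  suffices h : (fun k => ((coeff k (PowerSeries.mk (truncCoeff b n) *
      PowerSeries.mk sqrtOneSubCoeff) : ℝ) : ℂ) * z ^ k) = fun k => ∑ ij ∈ antidiagonal k,
      (truncCoeff b n ij.1 : ℂ) * z ^ ij.1 * ((sqrtOneSubCoeff ij.2 : ℂ) * z ^ ij.2) by
    rw [h]; exact h2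
  ext k
  rw [PowerSeries.coeff_mul]
  simp only [coeff_mk]
  push_cast
  rw [sum_mul]
  refine sum_congr rfl fun ij hij => ?_
  rw [← mem_antidiagonal.1 hij]
  ring

/-- Let `b` be the Taylor coefficients at `0` of the principal branch
of `√(1+z+z²)`. For every `n ≥ 0`, the Taylor polynomial `T_n(z) = ∑_{k=0}^n b_k z^k`
has no zeros in the closed unit disk. -/
theorem taylor_poly_no_zeros
    (b : ℕ → ℝ)
    (hb : ∀ᶠ z : ℂ in nhds 0,
      HasSum (fun k : ℕ => (b k : ℂ) * z ^ k) ((1 + z + z ^ 2) ^ ((1 : ℂ) / 2)))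
    (n : ℕ) :
    ∀ z : ℂ, ‖z‖ ≤ 1 → (∑ k ∈ Finset.range (n + 1), (b k : ℂ) * z ^ k) ≠ 0 := by
  intro z hz h0
  have hb := isSqrtCoeff_of_hasSum hb
  obtain hn | hn := lt_or_ge n 3
  · have b1 : b 1 = 1 / 2 := by have := hb.one; rw [hb.zero] at this; linarith
    have b2 : b 2 = 3 / 8 := by have := hb.two; rw [hb.zero, b1] at this; linarith
    have key : ∃ c : ℝ, 0 ≤ c ∧ c ≤ 3 / 8 ∧ ∃ e : ℝ, 0 ≤ e ∧ e ≤ 1 / 2 ∧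
        1 + (e : ℂ) * z + (c : ℂ) * z ^ 2 = 0 := by
      interval_cases n
      · exact ⟨0, le_rfl, by norm_num, 0, le_rfl, by norm_num, by simp [hb.zero] at h0⟩
      · exact ⟨0, le_rfl, by norm_num, 1 / 2, by norm_num, le_rfl,
          by simpa [sum_range_succ, hb.zero, b1] using h0⟩
      · exact ⟨3 / 8, by norm_num, le_rfl, 1 / 2, by norm_num, le_rfl,
          by simpa [sum_range_succ, hb.zero, b1, b2] using h0⟩
    obtain ⟨c, hc0, hc, e, he0, he, hsum⟩ := key
    have h1 : (1 : ℂ) = -((e : ℂ) * z + (c : ℂ) * z ^ 2) := by linear_combination hsum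
    have h2 : (1 : ℝ) ≤ e * ‖z‖ + c * ‖z‖ ^ 2 := by
      calc (1 : ℝ) = ‖(e : ℂ) * z + (c : ℂ) * z ^ 2‖ := by rw [← norm_neg, ← h1, norm_one]
        _ ≤ ‖(e : ℂ) * z‖ + ‖(c : ℂ) * z ^ 2‖ := norm_add_le _ _
        _ = e * ‖z‖ + c * ‖z‖ ^ 2 := by
          simp [abs_of_nonneg he0, abs_of_nonneg hc0]
    have h3 : ‖z‖ ^ 2 ≤ 1 := pow_le_one₀ (norm_nonneg _) hz
    nlinarith [norm_nonneg z]
  · obtain ⟨d, hd⟩ : ∃ d : ℕ → ℝ, d = fun k => PowerSeries.coeff k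
      (PowerSeries.mk (truncCoeff b n) * PowerSeries.mk sqrtOneSubCoeff) := ⟨_, rfl⟩
    obtain ⟨hnonpos, k, hk, hdk⟩ := coeff_trunc_mul_nonpos hb hn hd
    have hpos := sum_range_pos_of_isSqrtCoeff hb n
    have h3 : d 3 < 0 := by
      rw [hd]; exact (truncRecurrence hb hn).three_neg hn
    have hsum1 := hasSum_coeff_trunc_mul b n (z := 1) (by simp)
    have hsum2 := hasSum_coeff_trunc_mul b n hz
    rw [h0, zero_mul] at hsum2
    have hsumR : HasSum d ((∑ k ∈ range (n + 1), b k) * ∑' k, sqrtOneSubCoeff k) := by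
      rw [← Complex.hasSum_ofReal]
      simpa [hd, Complex.ofReal_tsum] using hsum1
    have hsum0 : 0 ≤ ∑' k, d k := by
      rw [hsumR.tsum_eq]
      exact mul_nonneg hpos.le sqrtOneSubCoeff.tsum_nonneg
    have hsumz : HasSum (fun k => (d k : ℂ) * z ^ k) 0 := by rw [hd]; exact hsum2
    have hpow {j : ℕ} (hj : d j < 0) : z ^ j = 1 :=
      eq_one_of_hasSum_zero hsumR.summable hnonpos hsum0 hz hsumz hj
    have hz1 := eq_one_of_pow_three_eq_one hk (hpow h3) (hpow hdk)
    rw [hz1] at h0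
    refine hpos.ne' ?_
    have : ((∑ k ∈ range (n + 1), b k : ℝ) : ℂ) = 0 := by simpa using h0
    exact_mod_cast this
end

section
/- (Szász) Let n ≥ 0 and let λ_0, …, λ_n, μ_0, …, μ_n be complex numbers such that the polynomial P_λ(z) = ∑_{k=0}^n λ_k z^k satisfies ∑_{i=0}^j λ_i λ_{j-i} = μ_j for every 0 ≤ j ≤ n (i.e. P_λ(z)² = μ_0 + μ_1 z + ⋯ + μ_n z^n + o(z^n) as z → 0). Then for any f(z) = ∑_{k=0}^∞ a_k z^k holomorphic on the open unit disk 𝔻 with |f(z)| ≤ 1 on 𝔻, one has |μ_n a_0 + μ_{n-1} a_1 + ⋯ + μ_0 a_n| ≤ |λ_0|² + ⋯ + |λ_n|². -/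
open Finset Metric

open Complex in
/-- Taylor coefficients of `f` at `0` via Cauchy's integral formula, with the convention that
coefficients of negative index vanish. -/
lemma circleIntegral_pow_div_pow_succ_mul {f : ℂ → ℂ} {a : ℕ → ℂ} {r : ℝ} (hr : 0 < r)
    (hf : DifferentiableOn ℂ f (closedBall 0 r))
    (ha : ∀ᶠ z : ℂ in nhds 0, HasSum (fun k : ℕ => a k * z ^ k) (f z)) (m n : ℕ) :
    (2 * Real.pi * I : ℂ)⁻¹ * ∮ z in C(0, r), z ^ m / z ^ (n + 1) * f z =
      if m ≤ n then a (n - m) else 0 := by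
  have hne : ∀ z ∈ sphere (0 : ℂ) r, z ≠ 0 := fun z hz => ne_of_mem_sphere hz hr.ne'
  split_ifs with hmn
  · lift r to NNReal using hr.le
    have h1 := hf.hasFPowerSeriesOnBall (by exact_mod_cast hr)
    have h2 : HasFPowerSeriesAt f (FormalMultilinearSeries.ofScalars ℂ a) 0 := by
      rw [hasFPowerSeriesAt_iff]
      filter_upwards [ha] with z hz
      simpa [FormalMultilinearSeries.coeff_ofScalars, mul_comm] using hz
    have h3 := h2.eq_formalMultilinearSeries h1.hasFPowerSeriesAt
    have h4 : a (n - m) = (cauchyPowerSeries f 0 r (n - m)) fun _ => (1 : ℂ) := by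
      rw [← h3]
      simp [FormalMultilinearSeries.ofScalars]
    rw [h4, cauchyPowerSeries_apply, smul_eq_mul]
    congr 1
    refine circleIntegral.integral_congr hr.le fun z hz => ?_
    have := hne z hz
    obtain ⟨k, rfl⟩ := Nat.exists_eq_add_of_le hmn
    simp only [sub_zero, smul_eq_mul, Nat.add_sub_cancel_left, one_div, inv_pow]
    field_simp
    ring
  · have h : ∮ z in C(0, r), z ^ m / z ^ (n + 1) * f z =
        ∮ z in C(0, r), z ^ (m - (n + 1)) * f z := by
      refine circleIntegral.integral_congr hr.le fun z hz => ?_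
      rw [pow_sub₀ _ (hne z hz) (by omega), div_eq_mul_inv]
    rw [h, DiffContOnCl.circleIntegral_eq_zero hr.le, mul_zero]
    refine DifferentiableOn.diffContOnCl ?_
    rw [closure_ball _ hr.ne']
    exact (differentiableOn_id.pow _).mul hf

lemma intervalIntegral_exp_int_mul_I (k : ℤ) :
    ∫ θ in (0 : ℝ)..2 * Real.pi, Complex.exp (k * Complex.I * θ) =
      if k = 0 then 2 * (Real.pi : ℂ) else 0 := by
  split_ifs with hk
  · simp [hk]
  · rw [integral_exp_mul_complex (by simp [hk])]
    have : Complex.exp (k * Complex.I * (2 * Real.pi : ℝ)) = 1 := by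
      rw [← Complex.exp_int_mul_two_pi_mul_I k]
      push_cast
      ring_nf
    rw [this]
    simp

/-- Parseval's identity for a polynomial on a circle. -/
lemma intervalIntegral_norm_sum_mul_circleMap_pow_sq (n : ℕ) (c : ℕ → ℂ) (r : ℝ) :
    ∫ θ in (0 : ℝ)..2 * Real.pi, ‖∑ i ∈ range n, c i * circleMap 0 r θ ^ i‖ ^ 2 =
      2 * Real.pi * ∑ i ∈ range n, ‖c i‖ ^ 2 * r ^ (2 * i) := by
  have key : ∀ θ : ℝ, ((‖∑ i ∈ range n, c i * circleMap 0 r θ ^ i‖ ^ 2 : ℝ) : ℂ) =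
      ∑ i ∈ range n, ∑ l ∈ range n, c i * (starRingEnd ℂ) (c l) * (r : ℂ) ^ (i + l) *
        Complex.exp (((i - l : ℤ) : ℂ) * Complex.I * θ) := by
    intro θ
    rw [Complex.ofReal_pow, ← Complex.mul_conj', map_sum, sum_mul_sum]
    refine sum_congr rfl fun i _ => sum_congr rfl fun l _ => ?_
    have : Complex.exp (((i - l : ℤ) : ℂ) * Complex.I * θ) =
        Complex.exp (θ * Complex.I) ^ i * Complex.exp (-(θ * Complex.I)) ^ l := by
      rw [← Complex.exp_nat_mul, ← Complex.exp_nat_mul, ← Complex.exp_add]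
      push_cast
      ring_nf
    rw [this]
    simp only [circleMap, zero_add, map_mul, map_pow, Complex.conj_ofReal, ← Complex.exp_conj,
      Complex.conj_I, mul_neg]
    ring
  apply Complex.ofReal_injective
  rw [← intervalIntegral.integral_ofReal]
  simp_rw [key]
  rw [intervalIntegral.integral_finsetSum
    fun i _ => Continuous.intervalIntegrable (by fun_prop) _ _]
  simp only [Complex.ofReal_mul, Complex.ofReal_sum, Complex.ofReal_pow, Complex.ofReal_ofNat]
  rw [mul_sum]
  refine sum_congr rfl fun i hi => ?_
  rw [intervalIntegral.integral_finsetSum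
    fun l _ => Continuous.intervalIntegrable (by fun_prop) _ _]
  simp_rw [intervalIntegral.integral_const_mul, intervalIntegral_exp_int_mul_I]
  rw [sum_eq_single_of_mem i hi fun l _ hl => by rw [if_neg (by omega), mul_zero]]
  rw [if_pos (by omega), Complex.mul_conj']
  ring

/-- The `n`-th Taylor coefficient of the product of the square of a polynomial with a power
series. -/
lemma sum_mul_sum_ite_eq_sum_cauchy_square {R : Type*} [CommSemiring R] (n : ℕ) (c a : ℕ → R) :
    ∑ i ∈ range (n + 1), ∑ l ∈ range (n + 1),
        c i * c l * (if i + l ≤ n then a (n - (i + l)) else 0) =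
      ∑ k ∈ range (n + 1), (∑ i ∈ range (n - k + 1), c i * c (n - k - i)) * a k := by
  simp_rw [mul_ite, mul_zero, sum_mul]
  rw [← sum_product', ← sum_filter, sum_sigma']
  refine sum_bij' (fun p _ => ⟨n - (p.1 + p.2), p.1⟩)
    (fun q _ => (q.2, n - q.1 - q.2)) ?_ ?_ ?_ ?_ ?_
  · rintro ⟨i, l⟩ h
    simp only [mem_filter, mem_product, mem_sigma, mem_range] at h ⊢
    omega
  · rintro ⟨k, i⟩ h
    simp only [mem_filter, mem_product, mem_sigma, mem_range] at h ⊢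
    omega
  · rintro ⟨i, l⟩ h
    simp only [mem_filter, mem_product, mem_range] at h
    simp only [Prod.mk.injEq, true_and]
    omega
  · rintro ⟨k, i⟩ h
    simp only [mem_sigma, mem_range] at h
    simp only [Sigma.mk.injEq, heq_eq_eq, and_true]
    omega
  · rintro ⟨i, l⟩ h
    simp only [mem_filter, mem_product, mem_range] at h
    have : n - (n - (i + l)) - i = l := by omega
    simp only [this]

/-- Bound for the `n`-th Taylor coefficient of `P ^ 2 * f`, for a polynomial `P` and a function `f`
bounded by `1`, from the circle of radius `r`. -/
lemma norm_sum_cauchy_square_mul_le_of_norm_le_one {f : ℂ → ℂ} {a : ℕ → ℂ} {r : ℝ} (hr : 0 < r)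
    (hf : DifferentiableOn ℂ f (closedBall 0 r)) (hf1 : ∀ z ∈ sphere (0 : ℂ) r, ‖f z‖ ≤ 1)
    (ha : ∀ᶠ z : ℂ in nhds 0, HasSum (fun k : ℕ => a k * z ^ k) (f z)) (n : ℕ) (c : ℕ → ℂ) :
    r ^ n * ‖∑ k ∈ range (n + 1), (∑ i ∈ range (n - k + 1), c i * c (n - k - i)) * a k‖ ≤
      ∑ k ∈ range (n + 1), ‖c k‖ ^ 2 * r ^ (2 * k) := by
  have hne : ∀ z ∈ sphere (0 : ℂ) r, z ≠ 0 := fun z hz => ne_of_mem_sphere hz hr.ne'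
  have hfc : ContinuousOn f (sphere 0 r) := hf.continuousOn.mono sphere_subset_closedBall
  have hint : ∀ m : ℕ, ContinuousOn (fun z => z ^ m / z ^ (n + 1) * f z) (sphere 0 r) := fun m =>
    ((continuousOn_id.pow m).div (continuousOn_id.pow _)
      fun z hz => pow_ne_zero _ (hne z hz)).mul hfc
  have hcoeff : ∑ k ∈ range (n + 1), (∑ i ∈ range (n - k + 1), c i * c (n - k - i)) * a k =
      (2 * Real.pi * Complex.I : ℂ)⁻¹ * ∮ z in C(0, r),
        (∑ i ∈ range (n + 1), c i * z ^ i) ^ 2 / z ^ (n + 1) * f z := by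
    have hexp : ∀ z : ℂ, (∑ i ∈ range (n + 1), c i * z ^ i) ^ 2 / z ^ (n + 1) * f z =
        ∑ i ∈ range (n + 1), ∑ l ∈ range (n + 1),
          c i * c l * (z ^ (i + l) / z ^ (n + 1) * f z) := by
      intro z
      rw [sq, sum_mul_sum, sum_div, sum_mul]
      refine sum_congr rfl fun i _ => ?_
      rw [sum_div, sum_mul]
      refine sum_congr rfl fun l _ => ?_
      ring
    have hterm : ∀ i l : ℕ, ContinuousOn
        (fun z => c i * c l * (z ^ (i + l) / z ^ (n + 1) * f z)) (sphere 0 r) :=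
      fun i l => continuousOn_const.mul (hint _)
    have hcont : ∀ i : ℕ, ContinuousOn (fun z => ∑ l ∈ range (n + 1),
        c i * c l * (z ^ (i + l) / z ^ (n + 1) * f z)) (sphere 0 r) :=
      fun i => continuousOn_finsetSum _ fun l _ => hterm i l
    simp_rw [hexp]
    rw [circleIntegral.integral_fun_sum fun i _ => ContinuousOn.circleIntegrable hr.le
      (hcont i), mul_sum,
      ← sum_mul_sum_ite_eq_sum_cauchy_square]
    refine sum_congr rfl fun i _ => ?_
    rw [circleIntegral.integral_fun_sum fun l _ => ContinuousOn.circleIntegrable hr.le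
      (hterm i l), mul_sum]
    refine sum_congr rfl fun l _ => ?_
    rw [circleIntegral.integral_const_mul, mul_left_comm,
      circleIntegral_pow_div_pow_succ_mul hr hf ha]
  have hbound : ‖∮ z in C(0, r), (∑ i ∈ range (n + 1), c i * z ^ i) ^ 2 / z ^ (n + 1) * f z‖ ≤
      ∫ θ in (0 : ℝ)..2 * Real.pi,
        (r ^ n)⁻¹ * ‖∑ i ∈ range (n + 1), c i * circleMap 0 r θ ^ i‖ ^ 2 := by
    refine intervalIntegral.norm_integral_le_of_norm_le Real.two_pi_pos.le
      (Filter.Eventually.of_forall fun θ _ => ?_)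
      (Continuous.intervalIntegrable (by fun_prop) _ _)
    have hθ := hf1 _ (circleMap_mem_sphere 0 hr.le θ)
    simp only [deriv_circleMap, smul_eq_mul, norm_mul, norm_div, norm_pow, norm_circleMap_zero,
      abs_of_pos hr, Complex.norm_I, mul_one]
    calc _ = (r ^ n)⁻¹ * ‖∑ i ∈ range (n + 1), c i * circleMap 0 r θ ^ i‖ ^ 2 *
          ‖f (circleMap 0 r θ)‖ := by
          field_simp
          ring
      _ ≤ _ := mul_le_of_le_one_right (by positivity) hθ
  rw [intervalIntegral.integral_const_mul, intervalIntegral_norm_sum_mul_circleMap_pow_sq] at hbound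
  rw [hcoeff, norm_mul, norm_inv]
  have h2π : ‖(2 * Real.pi * Complex.I : ℂ)‖ = 2 * Real.pi := by
    simp [abs_of_pos Real.pi_pos]
  rw [h2π]
  have := Real.pi_pos
  calc _ ≤ r ^ n * ((2 * Real.pi)⁻¹ * ((r ^ n)⁻¹ * (2 * Real.pi *
          ∑ i ∈ range (n + 1), ‖c i‖ ^ 2 * r ^ (2 * i)))) := by gcongr
    _ = _ := by field_simp

/-- **Szász.** Let `λ_0, …, λ_n, μ_0, …, μ_n ∈ ℂ` be such that
`P_λ(z)² = μ_0 + μ_1 z + ⋯ + μ_n z^n + o(z^n)`, i.e. `∑_{i=0}^j λ_i λ_{j-i} = μ_j`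
for `0 ≤ j ≤ n`. Then for any `f` holomorphic on the open unit disk with `|f| ≤ 1`
and Taylor coefficients `a_k`,
`|μ_n a_0 + μ_{n-1} a_1 + ⋯ + μ_0 a_n| ≤ |λ_0|² + ⋯ + |λ_n|²`. -/
theorem szasz_inequality
    (n : ℕ) (lam mu : ℕ → ℂ)
    (hP : ∀ j ≤ n, ∑ i ∈ Finset.range (j + 1), lam i * lam (j - i) = mu j)
    (f : ℂ → ℂ) (a : ℕ → ℂ)
    (hf : DifferentiableOn ℂ f (ball (0 : ℂ) 1))
    (hf1 : ∀ z ∈ ball (0 : ℂ) 1, ‖f z‖ ≤ 1)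
    (ha : ∀ᶠ z : ℂ in nhds 0, HasSum (fun k : ℕ => a k * z ^ k) (f z)) :
    ‖∑ k ∈ Finset.range (n + 1), mu (n - k) * a k‖ ≤
      ∑ k ∈ Finset.range (n + 1), ‖lam k‖ ^ 2 := by
  have hsum : ∑ k ∈ range (n + 1), mu (n - k) * a k =
      ∑ k ∈ range (n + 1), (∑ i ∈ range (n - k + 1), lam i * lam (n - k - i)) * a k :=
    sum_congr rfl fun k _ => by rw [hP _ (Nat.sub_le n k)]
  rw [hsum]
  set S := ∑ k ∈ range (n + 1), (∑ i ∈ range (n - k + 1), lam i * lam (n - k - i)) * a k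
  have hlim : Filter.Tendsto (fun r : ℝ => r ^ n * ‖S‖) (nhdsWithin 1 (Set.Iio 1))
      (nhds (1 ^ n * ‖S‖)) :=
    ((continuous_pow n).mul continuous_const).continuousAt.tendsto.mono_left nhdsWithin_le_nhds
  rw [one_pow, one_mul] at hlim
  refine le_of_tendsto hlim ?_
  filter_upwards [Ioo_mem_nhdsLT (zero_lt_one : (0 : ℝ) < 1)] with r hr
  refine (norm_sum_cauchy_square_mul_le_of_norm_le_one hr.1
    (hf.mono (closedBall_subset_ball hr.2))
    (fun z hz => hf1 z (sphere_subset_closedBall.trans (closedBall_subset_ball hr.2) hz))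
    ha n lam).trans ?_
  exact sum_le_sum fun k _ =>
    mul_le_of_le_one_right (by positivity) (pow_le_one₀ hr.1.le hr.2.le)
end

section
/- For every k ≥ 1 not divisible by 3, b_k > 0; and for every k ≥ 1 divisible by 3, b_k < 0. Moreover b_0 = 1. -/
open Finset

/-- Two power series with the same sum near `0` have the same coefficients. -/
theorem coeff_eq_of_eventually_hasSum {c d : ℕ → ℂ} {f : ℂ → ℂ}
    (hc : ∀ᶠ z : ℂ in nhds 0, HasSum (fun k : ℕ => c k * z ^ k) (f z))
    (hd : ∀ᶠ z : ℂ in nhds 0, HasSum (fun k : ℕ => d k * z ^ k) (f z)) : c = d := by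
  have key : ∀ {e : ℕ → ℂ}, (∀ᶠ z : ℂ in nhds 0, HasSum (fun k : ℕ => e k * z ^ k) (f z)) →
      HasFPowerSeriesAt f (FormalMultilinearSeries.ofScalars ℂ e) 0 := by
    intro e he
    rw [hasFPowerSeriesAt_iff]
    filter_upwards [he] with z hz
    simpa [FormalMultilinearSeries.coeff_ofScalars, mul_comm] using hz
  have h := (key hc).eq_formalMultilinearSeries (key hd)
  funext n
  simpa [FormalMultilinearSeries.coeff_ofScalars] using
    congrArg (fun p : FormalMultilinearSeries ℂ ℂ ℂ => p.coeff n) h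

/-- The generating series of the coefficients squares to `1 + X + X²`. -/
theorem mk_sq_eq_of_hasSum_sqrt {b : ℕ → ℝ}
    (hb : ∀ᶠ z : ℂ in nhds 0,
      HasSum (fun k : ℕ => (b k : ℂ) * z ^ k) ((1 + z + z ^ 2) ^ ((1 : ℂ) / 2))) :
    (PowerSeries.mk b) ^ 2 = 1 + PowerSeries.X + PowerSeries.X ^ 2 := by
  set d : ℕ → ℝ := fun n => PowerSeries.coeff n (1 + PowerSeries.X + PowerSeries.X ^ 2)
  have hprod : ∀ᶠ z : ℂ in nhds 0,
      HasSum (fun k : ℕ => (∑ p ∈ antidiagonal k, (b p.1 : ℂ) * b p.2) * z ^ k)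
        (1 + z + z ^ 2) := by
    filter_upwards [hb] with z hz
    have hn := hz.summable.norm
    have h := summable_norm_sum_mul_antidiagonal_of_summable_norm hn hn
    have h2 := h.of_norm.hasSum
    rw [← tsum_mul_tsum_eq_tsum_sum_antidiagonal_of_summable_norm hn hn, hz.tsum_eq,
      ← sq, one_div, Complex.cpow_ofNat_inv_pow] at h2
    refine Eq.mp (congrArg (fun g : ℕ → ℂ => HasSum g (1 + z + z ^ 2)) (funext fun k => ?_)) h2
    symm
    rw [sum_mul]
    refine sum_congr rfl fun p hp => ?_
    rw [← mem_antidiagonal.mp hp, pow_add]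
    ring
  have hpoly : ∀ᶠ z : ℂ in nhds 0,
      HasSum (fun k : ℕ => (d k : ℂ) * z ^ k) (1 + z + z ^ 2) := by
    refine Filter.Eventually.of_forall fun z => ?_
    have h := hasSum_sum_of_ne_finset_zero (f := fun k : ℕ => (d k : ℂ) * z ^ k)
      (s := range 3) (L := SummationFilter.unconditional ℕ) (by
        intro k hk
        have : 3 ≤ k := by simpa using hk
        have h0 : k ≠ 0 := by omega
        have h1 : k ≠ 1 := by omega
        have h2 : k ≠ 2 := by omega
        simp [d, PowerSeries.coeff_one, PowerSeries.coeff_X, PowerSeries.coeff_X_pow, h0, h1, h2])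
    simpa [d, sum_range_succ, PowerSeries.coeff_one, PowerSeries.coeff_X,
      PowerSeries.coeff_X_pow] using h
  have h := coeff_eq_of_eventually_hasSum hprod hpoly
  ext n
  have hn := congrFun h n
  rw [sq, PowerSeries.coeff_mul]
  simp only [PowerSeries.coeff_mk]
  exact_mod_cast hn

/-- The linear recurrence satisfied by the coefficients of a square root of `1 + X + X²`. -/
theorem recurrence_of_mk_sq_eq {b : ℕ → ℝ}
    (h : (PowerSeries.mk b) ^ 2 = 1 + PowerSeries.X + PowerSeries.X ^ 2) (k : ℕ) :
    ((k : ℝ) + 2) * b (k + 2) = -((k : ℝ) + 1 / 2) * b (k + 1) - ((k : ℝ) - 1) * b k := by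
  set F := PowerSeries.mk b
  have hd : 2 * F * PowerSeries.derivative ℝ F = 1 + 2 * PowerSeries.X := by
    have := congrArg (PowerSeries.derivative ℝ) h
    simpa [Derivation.leibniz_pow, PowerSeries.derivative_X, mul_assoc, two_mul, add_mul] using this
  have hode : 2 * ((1 + PowerSeries.X + PowerSeries.X ^ 2) * PowerSeries.derivative ℝ F)
      = (1 + 2 * PowerSeries.X) * F := by
    rw [← h, ← hd]; ring
  have hode' : 2 * (PowerSeries.derivative ℝ F + PowerSeries.X * PowerSeries.derivative ℝ F
      + PowerSeries.X * (PowerSeries.X * PowerSeries.derivative ℝ F))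
      = F + 2 * (PowerSeries.X * F) := by
    linear_combination hode
  have hk := congrArg (PowerSeries.coeff (k + 1)) hode'
  simp only [two_mul, map_add, PowerSeries.coeff_succ_X_mul, PowerSeries.coeff_derivative,
    PowerSeries.coeff_mk, F] at hk
  cases k with
  | zero =>
    simp only [PowerSeries.coeff_zero_X_mul] at hk
    push_cast at hk ⊢
    linarith
  | succ k =>
    simp only [PowerSeries.coeff_succ_X_mul, PowerSeries.coeff_derivative,
      PowerSeries.coeff_mk] at hk
    push_cast at hk ⊢
    linarith

theorem coeff_signs
    (b : ℕ → ℝ)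
    (hb : ∀ᶠ z : ℂ in nhds 0,
      HasSum (fun k : ℕ => (b k : ℂ) * z ^ k) ((1 + z + z ^ 2) ^ ((1 : ℂ) / 2))) :
    b 0 = 1 ∧
      (∀ k : ℕ, 1 ≤ k → ¬ (3 ∣ k) → 0 < b k) ∧
      (∀ k : ℕ, 1 ≤ k → 3 ∣ k → b k < 0) := by
  have hsq := mk_sq_eq_of_hasSum_sqrt hb
  have hrec := recurrence_of_mk_sq_eq hsq
  have h0 : b 0 = 1 := by
    have h := hb.self_of_nhds
    have h' := hasSum_single (f := fun k : ℕ => (b k : ℂ) * 0 ^ k) 0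
      (fun k hk => by simp [hk])
    simpa using h'.unique h
  have h1 : b 1 = 1 / 2 := by
    have h := congrArg (PowerSeries.coeff 1) hsq
    rw [sq, PowerSeries.coeff_mul] at h
    simp [Nat.antidiagonal_succ, PowerSeries.coeff_one, PowerSeries.coeff_X_pow, h0] at h
    linarith
  have h2 : b 2 = 3 / 8 := by have := hrec 0; norm_num [h0, h1] at this; linarith
  have h3 : b 3 = -3 / 16 := by have := hrec 1; norm_num [h1, h2] at this; linarith
  have h4 : b 4 = 3 / 128 := by have := hrec 2; norm_num [h2, h3] at this; linarith
  have hmid : ∀ n : ℕ, 3 ≤ n → b n < 0 → 2 * (n : ℝ) * b (n + 1) ≤ ((n : ℝ) - 2) * -b n →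
      0 < b (n + 2) := by
    intro n hn ha hc
    have hn' : (3 : ℝ) ≤ n := by exact_mod_cast hn
    have hr := hrec n
    have : 0 < 2 * (n : ℝ) * (((n : ℝ) + 2) * b (n + 2)) := by
      rw [hr]
      nlinarith [mul_le_mul_of_nonneg_left hc (by linarith : (0 : ℝ) ≤ n + 1 / 2),
        mul_pos (by nlinarith : (0 : ℝ) < 2 * n * (n - 1) - (n + 1 / 2) * (n - 2)) (neg_pos.2 ha)]
    have h' : 0 < 2 * (n : ℝ) * ((n : ℝ) + 2) := by positivity
    rw [← mul_assoc] at this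
    exact pos_of_mul_pos_right this h'.le
  have key : ∀ m : ℕ, b (3 * m + 3) < 0 ∧ 0 < b (3 * m + 4) ∧
      2 * ((3 * m + 3 : ℕ) : ℝ) * b (3 * m + 4) ≤
        (((3 * m + 3 : ℕ) : ℝ) - 2) * -b (3 * m + 3) := by
    intro m
    induction m with
    | zero => norm_num [h3, h4]
    | succ m ih =>
      obtain ⟨ha, hc, hu⟩ := ih
      have hB := hmid _ (by omega) ha hu
      have e0 := hrec (3 * m + 3)
      have e1 := hrec (3 * m + 4)
      have e2 := hrec (3 * m + 5)
      rw [show 3 * (m + 1) + 3 = 3 * m + 6 by ring, show 3 * (m + 1) + 4 = 3 * m + 7 by ring]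
      have hn : (3 : ℝ) ≤ ((3 * m + 3 : ℕ) : ℝ) := by exact_mod_cast (by omega)
      rw [show ((3 * m + 4 : ℕ) : ℝ) = ((3 * m + 3 : ℕ) : ℝ) + 1 by push_cast; ring] at e1
      rw [show ((3 * m + 5 : ℕ) : ℝ) = ((3 * m + 3 : ℕ) : ℝ) + 2 by push_cast; ring] at e2
      rw [show ((3 * m + 6 : ℕ) : ℝ) = ((3 * m + 3 : ℕ) : ℝ) + 3 by push_cast; ring]
      norm_num only [add_assoc] at e0 e1 e2 hB
      generalize ((3 * m + 3 : ℕ) : ℝ) = n at *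
      generalize b (3 * m + 3) = x0 at *
      generalize b (3 * m + 4) = x1 at *
      generalize b (3 * m + 5) = x2 at *
      generalize b (3 * m + 6) = x3 at *
      generalize b (3 * m + 7) = x4 at *
      have p3 : x3 < 0 := by
        have : 0 < n * x1 := by positivity
        have : 0 < (n + 3 / 2) * x2 := by positivity
        by_contra! hx
        nlinarith [mul_nonneg (by linarith : 0 ≤ n + 3) hx]
      have E4 : (n + 3) * ((n + 4) * x4) = 3 / 4 * x2 + n * (n + 5 / 2) * x1 := by
        linear_combination (n + 3) * e2 - (n + 5 / 2) * e1
      refine ⟨p3, ?_, ?_⟩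
      · have : 0 < (n + 3) * ((n + 4) * x4) := by rw [E4]; positivity
        exact pos_of_mul_pos_right (pos_of_mul_pos_right this (by linarith)) (by linarith)
      · have hS : 0 ≤ (2 * n ^ 4 + 15 * n ^ 3 + 145 / 4 * n ^ 2 + 57 / 2 * n + 3 / 4)
            * ((n - 2) * -x0 - 2 * n * x1) :=
          mul_nonneg (by positivity) (by linarith)
        have hA : 0 ≤ (3 / 4 * n ^ 3 + 27 * n ^ 2 + 213 / 4 * n + 3 / 2) * -x0 :=
          mul_nonneg (by positivity) (by linarith)
        have hG : 2 * n * (n + 2) * (n + 3) * (n + 4) * ((n + 3 - 2) * -x3 - 2 * (n + 3) * x4)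
            = (2 * n ^ 4 + 15 * n ^ 3 + 145 / 4 * n ^ 2 + 57 / 2 * n + 3 / 4)
              * ((n - 2) * -x0 - 2 * n * x1)
              + (3 / 4 * n ^ 3 + 27 * n ^ 2 + 213 / 4 * n + 3 / 2) * -x0 := by
          linear_combination -(2 * n * (n + 2) * (n + 1) * (n + 4)) * e1
            - 4 * n * (n + 2) * (n + 3) * E4
            + 2 * n * ((n + 1) * (n + 4) * (n + 3 / 2) - 3 / 2 * (n + 3)) * e0
        have hp : 0 < 2 * n * (n + 2) * (n + 3) * (n + 4) := by positivity
        exact sub_nonneg.1 (nonneg_of_mul_nonneg_right (hG ▸ add_nonneg hS hA) hp)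
  refine ⟨h0, fun k hk hd => ?_, fun k hk hd => ?_⟩
  · rcases lt_or_ge k 3 with hlt | hge
    · interval_cases k <;> norm_num [h1, h2]
    · obtain ⟨m, rfl | rfl⟩ : ∃ m, k = 3 * m + 4 ∨ k = 3 * m + 5 := ⟨(k - 3) / 3, by omega⟩
      · exact (key m).2.1
      · exact hmid _ (by omega) (key m).1 (key m).2.2
  · obtain ⟨m, rfl⟩ : ∃ m, k = 3 * m + 3 := ⟨(k - 3) / 3, by omega⟩
    exact (key m).1
end
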